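/- arXiv:1210.4775 — 8 statements merged into one kernel-verified Lean document; each statement's English description precedes it below -/
import Mathlib

section
/- Let n, m ≥ 2. The number of E-preserving partial transformations of Ω = Fin n × Fin m equals (m·(n+1)^n − m + 1)^m. Concretely, the number of functions α : Fin n × Fin m → Option (Fin n × Fin m) such that for all i, k ∈ Fin n and j ∈ Fin m, if α(i,j) = some (a,b) and α(k,j) = some (c,d) then b = d, equals (m·(n+1)^n − m + 1)^m. -/
/-- A partial map `f` from `ι` to `κ × β` whose defined values all share their second
coordinate. -/
def HasConstSnd {ι κ β : Type*} (f : ι → Option (κ × β)) : Prop :=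
  ∀ (i k : ι) (a c : κ) (b d : β), f i = some (a, b) → f k = some (c, d) → b = d

/-- The partial map with constant second coordinate built from a common second coordinate and a
nonempty partial map, or the empty partial map. -/
def constSndOfOption {ι κ β : Type*} :
    Option (β × {g : ι → Option κ // g ≠ fun _ => none}) →
      {f : ι → Option (κ × β) // HasConstSnd f}
  | none => ⟨fun _ => none, by simp [HasConstSnd]⟩
  | some (b, g) => ⟨fun i => (g.1 i).map (·, b), by
      intro i k a c b' d h h'
      simp only [Option.map_eq_some_iff, Prod.mk.injEq] at h h'
      grind⟩

theorem constSndOfOption_injective {ι κ β : Type*} :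
    Function.Injective (constSndOfOption (ι := ι) (κ := κ) (β := β)) := by
  have key : ∀ (b : β) (g : {g : ι → Option κ // g ≠ fun _ => none}),
      (fun i => (g.1 i).map (·, b)) ≠ fun _ => none := by
    intro b g h
    refine g.2 (funext fun i => ?_)
    simpa using congrFun h i
  rintro (_ | ⟨b, g⟩) (_ | ⟨b', g'⟩) h
  · rfl
  · exact absurd (congrArg Subtype.val h).symm (key b' g')
  · exact absurd (congrArg Subtype.val h) (key b g)
  · have h' : ∀ i, (g.1 i).map (·, b) = (g'.1 i).map (·, b') :=
      congrFun (congrArg Subtype.val h)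
    have hg : g = g' := by
      refine Subtype.ext (funext fun i => ?_)
      simpa [Function.comp_def] using congrArg (Option.map Prod.fst) (h' i)
    subst hg
    obtain ⟨i, hi⟩ := Function.ne_iff.mp g.2
    obtain ⟨a, ha⟩ := Option.ne_none_iff_exists'.mp hi
    have hb := h' i
    simp only [ha, Option.map_some, Option.some.injEq, Prod.mk.injEq, true_and] at hb
    rw [hb]

theorem constSndOfOption_surjective {ι κ β : Type*} :
    Function.Surjective (constSndOfOption (ι := ι) (κ := κ) (β := β)) := by
  rintro ⟨f, hf⟩
  by_cases h : f = fun _ => none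
  · exact ⟨none, Subtype.ext h.symm⟩
  · obtain ⟨i, hi⟩ := Function.ne_iff.mp h
    obtain ⟨⟨a, b⟩, hab⟩ := Option.ne_none_iff_exists'.mp hi
    refine ⟨some (b, ⟨fun k => (f k).map Prod.fst, fun h0 => ?_⟩), Subtype.ext (funext fun k => ?_)⟩
    · simpa [hab] using congrFun h0 i
    · change ((f k).map Prod.fst).map (·, b) = f k
      rcases hk : f k with _ | ⟨c, d⟩
      · rfl
      · simp [hf i k a c b d hab hk]

theorem card_hasConstSnd (ι κ β : Type*) [Finite ι] [Finite κ] [Finite β] :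
    Nat.card {f : ι → Option (κ × β) // HasConstSnd f} =
      Nat.card β * ((Nat.card κ + 1) ^ Nat.card ι - 1) + 1 := by
  classical
  have := Fintype.ofFinite ι
  have := Fintype.ofFinite κ
  rw [← Nat.card_congr (Equiv.ofBijective _
    ⟨constSndOfOption_injective (ι := ι) (κ := κ) (β := β), constSndOfOption_surjective⟩),
    Finite.card_option, Nat.card_prod]
  congr 2
  rw [Nat.card_eq_fintype_card, Fintype.card_subtype_compl, Fintype.card_subtype_eq]
  simp

/-- The blocks of a family of partial maps, each having constant second coordinate. -/
def blockEquiv (ι κ β γ : Type*) :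
    {α : ι × γ → Option (κ × β) // ∀ (i k : ι) (j : γ) (a c : κ) (b d : β),
        α (i, j) = some (a, b) → α (k, j) = some (c, d) → b = d} ≃
      (γ → {f : ι → Option (κ × β) // HasConstSnd f}) where
  toFun α j := ⟨fun i => α.1 (i, j), fun i k => α.2 i k j⟩
  invFun F := ⟨fun x => (F x.2).1 x.1, fun i k j => (F j).2 i k⟩
  left_inv _ := rfl
  right_inv _ := rfl

/-- The number of partial transformations of `Fin n × Fin m` (encoded as functions to
`Option (Fin n × Fin m)`) preserving the uniform equivalence `(i,j) E (k,l) ↔ j = l`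
equals `(m(n+1)^n - m + 1)^m`. -/
theorem stmt0 (n m : ℕ) (hn : 2 ≤ n) (hm : 2 ≤ m) :
    Nat.card {α : Fin n × Fin m → Option (Fin n × Fin m) //
        ∀ (i k : Fin n) (j : Fin m) (a c : Fin n) (b d : Fin m),
          α (i, j) = some (a, b) → α (k, j) = some (c, d) → b = d} =
      (m * (n + 1) ^ n - m + 1) ^ m := by
  rw [Nat.card_congr (blockEquiv (Fin n) (Fin n) (Fin m) (Fin m)), Nat.card_fun,
    card_hasConstSnd]
  simp [Nat.mul_sub]
end

section
/- Let n, m ≥ 2. The map φ : PT_n ≀ T_m → PT_{n×m} is surjective: every E-preserving partial transformation α of Fin n × Fin m is of the form φ(f,τ) for some f : Fin m → PT_n and τ : Fin m → Fin m. -/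
/-- The monoid of partial transformations of `Ω`, encoded as functions
`Ω → Option Ω`; multiplication is left-to-right composition. -/
def PT (Ω : Type) : Type := Ω → Option Ω

instance PT.instOne {Ω : Type} : One (PT Ω) := ⟨fun x => some x⟩

instance PT.instMul {Ω : Type} : Mul (PT Ω) := ⟨fun f g x => (f x).bind g⟩

instance PT.instMonoid {Ω : Type} : Monoid (PT Ω) where
  mul_assoc f g h := by
    funext x
    show ((f x).bind g).bind h = (f x).bind fun y => (g y).bind h
    cases f x <;> rfl
  one_mul f := rfl
  mul_one f := by
    funext x
    show (f x).bind (fun y => some y) = f x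
    cases f x <;> rfl

/-- The empty partial transformation. -/
def PT.empty (Ω : Type) : PT Ω := fun _ => none

/-- A partial transformation of `Fin n × Fin m` preserves the uniform
equivalence `(i,j) E (k,l) ↔ j = l` if images of points in the same class
lie in the same class. -/
def PreservesE (n m : ℕ) (α : PT (Fin n × Fin m)) : Prop :=
  ∀ (i k : Fin n) (j : Fin m) (a c : Fin n) (b d : Fin m),
    α (i, j) = some (a, b) → α (k, j) = some (c, d) → b = d
/-- The map `φ`, sending `(f, τ)` to the partial transformation with domain
`{(i,j) : i ∈ Dom (f j)}` mapping `(i,j)` to `(i(f j), τ j)`. -/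
def phi (n m : ℕ) (f : Fin m → PT (Fin n)) (τ : Fin m → Fin m) : PT (Fin n × Fin m) :=
  fun p => (f p.2 p.1).map fun i => (i, τ p.2)

/-- `φ : PT_n ≀ T_m → PT_{n×m}` is surjective: every `E`-preserving partial
transformation of `Fin n × Fin m` is of the form `φ (f, τ)`. -/
theorem stmt1 (n m : ℕ) (hn : 2 ≤ n) (hm : 2 ≤ m)
    (α : PT (Fin n × Fin m)) (hα : PreservesE n m α) :
    ∃ (f : Fin m → PT (Fin n)) (τ : Fin m → Fin m), phi n m f τ = α := by
  have hτ : ∀ j, ∃ t, ∀ i a b, α (i, j) = some (a, b) → b = t := by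
    intro j
    by_cases h : ∃ i a b, α (i, j) = some (a, b)
    · obtain ⟨k, c, d, hd⟩ := h
      exact ⟨d, fun i a b hb => hα i k j a c b d hb hd⟩
    · exact ⟨j, fun i a b hb => (h ⟨i, a, b, hb⟩).elim⟩
  choose τ hτ using hτ
  refine ⟨fun j i => (α (i, j)).map Prod.fst, τ, ?_⟩
  funext ⟨i, j⟩
  change ((α (i, j)).map Prod.fst).map (fun k => (k, τ j)) = α (i, j)
  rcases h : α (i, j) with _ | ⟨a, b⟩
  · rfl
  · simp [hτ j i a b h]
end

section
/- Let n, m ≥ 2 and let f, g : Fin m → PT_n and σ, τ : Fin m → Fin m. Then φ(f,σ) = φ(g,τ) if and only if f j = g j for all j ∈ Fin m, and σ j = τ j for every j such that f j is not the empty partial transformation. -/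
/-- `φ(f,σ) = φ(g,τ)` iff `f j = g j` for all `j`, and `σ j = τ j` whenever
`f j` is not the empty partial transformation. -/
theorem stmt2 (n m : ℕ) (hn : 2 ≤ n) (hm : 2 ≤ m)
    (f g : Fin m → PT (Fin n)) (σ τ : Fin m → Fin m) :
    phi n m f σ = phi n m g τ ↔
      (∀ j, f j = g j) ∧ ∀ j, f j ≠ PT.empty (Fin n) → σ j = τ j := by
  constructor
  · intro h
    have key : ∀ j i, (f j i).map (fun a => (a, σ j)) = (g j i).map fun a => (a, τ j) :=
      fun j i => congrFun h (i, j)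
    refine ⟨fun j => funext fun i => ?_, fun j hj => ?_⟩
    · simpa [Option.map_map, Function.comp_def] using congrArg (Option.map Prod.fst) (key j i)
    · obtain ⟨i, hi⟩ := Function.ne_iff.mp hj
      obtain ⟨a, ha⟩ := Option.ne_none_iff_exists'.mp hi
      have hk := key j i
      rw [ha] at hk
      obtain ⟨b, -, hb⟩ := Option.map_eq_some_iff.mp hk.symm
      exact (congrArg Prod.snd hb).symm
  · rintro ⟨hfg, hστ⟩
    obtain rfl : f = g := funext hfg
    funext ⟨i, j⟩
    show (f j i).map (fun a => (a, σ j)) = (f j i).map fun a => (a, τ j)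
    by_cases hj : f j = PT.empty (Fin n)
    · rw [hj]
      rfl
    · rw [hστ j hj]
end

section
/- Let n, m ≥ 2. The map φ : PT_n ≀ T_m → PT_{n×m} is a monoid homomorphism: φ of the identity (const id, id) is the identity partial transformation, and φ((f,σ)(g,τ)) = φ(f,σ)·φ(g,τ) for all (f,σ), (g,τ) ∈ PT_n ≀ T_m. -/
/-- The wreath product `PT_n ≀ T_m`: underlying set `(Fin m → PT (Fin n)) × (Fin m → Fin m)`. -/
def W (n m : ℕ) : Type := (Fin m → PT (Fin n)) × (Fin m → Fin m)

instance W.instOne {n m : ℕ} : One (W n m) := ⟨(fun _ => 1, fun j => j)⟩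

instance W.instMul {n m : ℕ} : Mul (W n m) :=
  ⟨fun a b => (fun j => a.1 j * b.1 (a.2 j), fun j => b.2 (a.2 j))⟩

instance W.instMonoid {n m : ℕ} : Monoid (W n m) where
  mul_assoc a b c := Prod.ext (funext fun j => mul_assoc _ _ _) rfl
  one_mul a := rfl
  mul_one a := Prod.ext (funext fun j => mul_one _) rfl

/-- The map `φ : PT_n ≀ T_m → PT_{n×m}`. -/
def phiW (n m : ℕ) (w : W n m) : PT (Fin n × Fin m) :=
  fun p => (w.1 p.2 p.1).map fun i => (i, w.2 p.2)

/-- `φ : PT_n ≀ T_m → PT_{n×m}` is a monoid homomorphism: its values preserve `E`,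
it maps the identity to the identity, and it is multiplicative. -/
theorem stmt3 (n m : ℕ) (hn : 2 ≤ n) (hm : 2 ≤ m) :
    (∀ w : W n m, PreservesE n m (phiW n m w)) ∧
      phiW n m 1 = 1 ∧
        ∀ a b : W n m, phiW n m (a * b) = phiW n m a * phiW n m b := by
  refine ⟨fun w i k j a c b d hb hd => ?_, rfl, fun a b => ?_⟩
  · obtain ⟨_, _, hb⟩ := Option.map_eq_some_iff.mp hb
    obtain ⟨_, _, hd⟩ := Option.map_eq_some_iff.mp hd
    exact (congrArg Prod.snd hb).symm.trans (congrArg Prod.snd hd)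
  · funext ⟨i, j⟩
    show ((a.1 j i).bind (b.1 (a.2 j))).map (fun k => (k, b.2 (a.2 j))) =
      ((a.1 j i).map fun k => (k, a.2 j)).bind (phiW n m b)
    cases a.1 j i <;> rfl
end

section
/- Let n, m ≥ 2. The congruence Ker φ on the wreath product PT_n ≀ T_m (the congruence relating (f,σ) and (g,τ) iff φ(f,σ) = φ(g,τ)) is generated by the single pair (a, a·b), where a = (e, id) with e : Fin m → PT_n given by e(1) = ∅ (the empty partial transformation) and e(j) = id for j ≠ 1, and b = (const id, t) with t : Fin m → Fin m the map sending 1 ↦ 2 and fixing all other points. That is, Con.ker φ equals the congruence generated by {(a, a·b)}. -/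
/-- Constructor for elements of the wreath product. -/
def W.mk {n m : ℕ} (f : Fin m → PT (Fin n)) (τ : Fin m → Fin m) : W n m := (f, τ)

/-- `phiW` as a multiplicative homomorphism. -/
def phiWHom (n m : ℕ) : W n m →ₙ* PT (Fin n × Fin m) where
  toFun := phiW n m
  map_mul' x y := by
    funext p
    change ((x.1 p.2 p.1).bind (y.1 (x.2 p.2))).map _ = ((x.1 p.2 p.1).map _).bind _
    cases x.1 p.2 p.1 <;> rfl

theorem PT.empty_mul {Ω : Type} (f : PT Ω) : PT.empty Ω * f = PT.empty Ω := rfl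

theorem W.mk_mul_mk {n m : ℕ} (f g : Fin m → PT (Fin n)) (σ τ : Fin m → Fin m) :
    W.mk f σ * W.mk g τ = W.mk (fun j => f j * g (σ j)) (fun j => τ (σ j)) := rfl

theorem phiW_mk_eq_iff {n m : ℕ} (f g : Fin m → PT (Fin n)) (σ τ : Fin m → Fin m) :
    phiW n m (W.mk f σ) = phiW n m (W.mk g τ) ↔
      f = g ∧ ∀ j, f j ≠ PT.empty (Fin n) → σ j = τ j := by
  constructor
  · intro h
    have key (i : Fin n) (j : Fin m) :
        (f j i).map (fun k => (k, σ j)) = (g j i).map (fun k => (k, τ j)) :=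
      congrFun h (i, j)
    refine ⟨funext fun j => funext fun i => ?_, fun j hj => ?_⟩
    · have := key i j
      cases hf : f j i <;> cases hg : g j i <;> simp_all
    · obtain ⟨i, hi⟩ := Function.ne_iff.mp hj
      have := key i j
      change f j i ≠ none at hi
      cases hf : f j i <;> cases hg : g j i <;> simp_all
  · rintro ⟨rfl, h⟩
    funext ⟨i, j⟩
    change (f j i).map (fun k => (k, σ j)) = (f j i).map (fun k => (k, τ j))
    by_cases hj : f j = PT.empty (Fin n)
    · rw [hj]
      rfl
    · rw [h j hj]

theorem exists_perm_apply_eq_apply_eq {α : Type*} [DecidableEq α] {a b c d : α}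
    (hab : a ≠ b) (hcd : c ≠ d) : ∃ π : Equiv.Perm α, π a = c ∧ π b = d := by
  have hc : c ≠ Equiv.swap a c b := by
    intro h
    apply hab
    apply (Equiv.swap a c).injective
    rw [Equiv.swap_apply_left, ← h]
  refine ⟨(Equiv.swap a c).trans (Equiv.swap (Equiv.swap a c b) d), ?_, ?_⟩
  · simp [Equiv.swap_apply_of_ne_of_ne hc hcd]
  · simp

section

variable {n m : ℕ} {c : Con (W n m)} {p q : Fin m}

/-- A congruence relating `a` and `a * b` allows one to copy a value of the `T_m` component to any
place where the `PT_n` component is empty. -/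
theorem Con.rel_mk_update_apply (hpq : p ≠ q)
    (hc : c (W.mk (fun j => if j = p then PT.empty (Fin n) else 1) (fun j => j))
      (W.mk (fun j => if j = p then PT.empty (Fin n) else 1) (fun j => j) *
        W.mk (fun _ => 1) (fun j => if j = p then q else j)))
    {f : Fin m → PT (Fin n)} (σ : Fin m → Fin m) {j k : Fin m} (hjk : j ≠ k)
    (hf : f j = PT.empty (Fin n)) :
    c (W.mk f σ) (W.mk f (Function.update σ j (σ k))) := by
  obtain ⟨π, hj, hk⟩ := exists_perm_apply_eq_apply_eq hjk hpq
  have hp (i : Fin m) : π i = p ↔ i = j := by rw [← hj, π.injective.eq_iff]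
  have hq : π.symm q = k := by rw [← hk, π.symm_apply_apply]
  have h := c.mul (c.mul (c.refl (W.mk (fun _ => 1) π)) hc)
    (c.refl (W.mk (fun i => f (π.symm i)) (fun i => σ (π.symm i))))
  simp only [W.mk_mul_mk, one_mul, mul_one, hp] at h
  convert h using 2
  · funext i
    by_cases hi : i = j <;> simp [hi, hf, PT.empty_mul]
  · simp
  · funext i
    by_cases hi : i = j <;> simp [hi, hf, PT.empty_mul]
  · funext i
    by_cases hi : i = j <;> simp [hi, hq]

theorem Con.rel_mk_update (hpq : p ≠ q)
    (hc : c (W.mk (fun j => if j = p then PT.empty (Fin n) else 1) (fun j => j))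
      (W.mk (fun j => if j = p then PT.empty (Fin n) else 1) (fun j => j) *
        W.mk (fun _ => 1) (fun j => if j = p then q else j)))
    {f : Fin m → PT (Fin n)} (σ : Fin m → Fin m) {j : Fin m} (v : Fin m)
    (hf : f j = PT.empty (Fin n)) :
    c (W.mk f σ) (W.mk f (Function.update σ j v)) := by
  have : Nontrivial (Fin m) := ⟨p, q, hpq⟩
  obtain ⟨k, hk⟩ := exists_ne j
  have h := Con.rel_mk_update_apply hpq hc (Function.update σ j v) hk.symm hf
  rw [Function.update_idem, Function.update_of_ne hk] at h
  exact c.trans (Con.rel_mk_update_apply hpq hc σ hk.symm hf) (c.symm h)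

theorem Con.rel_mk_of_eq_of_ne_empty (hpq : p ≠ q)
    (hc : c (W.mk (fun j => if j = p then PT.empty (Fin n) else 1) (fun j => j))
      (W.mk (fun j => if j = p then PT.empty (Fin n) else 1) (fun j => j) *
        W.mk (fun _ => 1) (fun j => if j = p then q else j)))
    {f : Fin m → PT (Fin n)} {σ τ : Fin m → Fin m}
    (h : ∀ j, f j ≠ PT.empty (Fin n) → σ j = τ j) :
    c (W.mk f σ) (W.mk f τ) := by
  have key (s : Finset (Fin m)) : c (W.mk f σ) (W.mk f (s.piecewise τ σ)) := by
    induction s using Finset.induction_on with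
    | empty => simpa using c.refl _
    | insert j s _ ih =>
      rw [Finset.piecewise_insert]
      by_cases hj : f j = PT.empty (Fin n)
      · exact c.trans ih (Con.rel_mk_update hpq hc _ _ hj)
      · have hs : s.piecewise τ σ j = τ j := by
          by_cases hjs : j ∈ s <;> simp [hjs, h j hj]
        rwa [← hs, Function.update_eq_self]
  simpa using key Finset.univ

end

/-- The congruence `Ker φ` on `PT_n ≀ T_m` is generated by the single pair `(a, a·b)`,
where `a = (e, id)` with `e 0 = ∅`, `e j = 1` for `j ≠ 0`, and `b = (const 1, t)` with
`t` sending `0 ↦ 1` and fixing all other points (0-indexed). -/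
theorem stmt4 (n m : ℕ) (hn : 2 ≤ n) (hm : 2 ≤ m) :
    ∀ x y : W n m,
      conGen
          (fun u v : W n m =>
            u = W.mk (fun j => if j = (⟨0, by omega⟩ : Fin m) then PT.empty (Fin n) else 1)
                  (fun j => j) ∧
              v = u * W.mk (fun _ => 1)
                    (fun j => if j = (⟨0, by omega⟩ : Fin m) then (⟨1, by omega⟩ : Fin m) else j))
          x y ↔
        phiW n m x = phiW n m y := by
  intro x y
  have hpq : (⟨0, by omega⟩ : Fin m) ≠ ⟨1, by omega⟩ := by simp
  constructor
  · intro h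
    refine (Con.conGen_le (c := Con.ker (phiWHom n m))).mpr ?_ h
    rintro u v ⟨rfl, rfl⟩
    change phiW n m _ = phiW n m _
    rw [W.mk_mul_mk, phiW_mk_eq_iff]
    refine ⟨by simp only [mul_one], fun j hj => ?_⟩
    by_cases h0 : j = ⟨0, by omega⟩ <;> simp_all
  · obtain ⟨f, σ⟩ := x
    obtain ⟨g, τ⟩ := y
    intro h
    obtain ⟨rfl, hστ⟩ := (phiW_mk_eq_iff f g σ τ).mp h
    exact Con.rel_mk_of_eq_of_ne_empty hpq (ConGen.Rel.of _ _ ⟨rfl, rfl⟩) hστ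
end

section
/- Let n, m ≥ 2. For every E-preserving partial transformation α of Fin n × Fin m there exists a unique pair (f,τ) with f : Fin m → PT_n and τ : Fin m → Fin m such that φ(f,τ) = α and τ(j) = 1 for every j with f j equal to the empty partial transformation. (Every congruence class of Ker φ contains precisely one element in canonical form.) -/
/-- The first components of `(f, τ)` are recovered from `φ(f, τ)` by forgetting the class. -/
lemma map_fst_phi {n m : ℕ} (f : Fin m → PT (Fin n)) (τ : Fin m → Fin m) (i : Fin n)
    (j : Fin m) : (phi n m f τ (i, j)).map Prod.fst = f j i := by
  simp [phi, Function.comp_def]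

/-- The value `τ j` is recovered from `φ(f, τ)` whenever `f j` is not empty. -/
lemma phi_snd_injective {n m : ℕ} {f : Fin m → PT (Fin n)} {τ σ : Fin m → Fin m}
    (h : phi n m f τ = phi n m f σ) {j : Fin m} (hj : f j ≠ PT.empty (Fin n)) :
    τ j = σ j := by
  obtain ⟨i, hi⟩ := Function.ne_iff.mp hj
  obtain ⟨a, ha⟩ := Option.ne_none_iff_exists'.mp hi
  simpa [phi, ha] using congrFun h (i, j)

/-- An `E`-preserving partial transformation induces a map of classes, which may be given any
value `z` on the classes disjoint from the domain. -/
lemma PreservesE.exists_classMap {n m : ℕ} {α : PT (Fin n × Fin m)} (hα : PreservesE n m α)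
    (z : Fin m) : ∃ τ : Fin m → Fin m,
      (∀ i j a b, α (i, j) = some (a, b) → b = τ j) ∧
        ∀ j, (∀ i, α (i, j) = none) → τ j = z := by
  have key : ∀ j, ∃ t : Fin m,
      (∀ i a b, α (i, j) = some (a, b) → b = t) ∧ ((∀ i, α (i, j) = none) → t = z) := by
    intro j
    by_cases h : ∀ i, α (i, j) = none
    · exact ⟨z, fun i a b hi => by simp [h i] at hi, fun _ => rfl⟩
    · obtain ⟨k, hk⟩ := not_forall.mp h
      obtain ⟨⟨c, d⟩, hcd⟩ := Option.ne_none_iff_exists'.mp hk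
      exact ⟨d, fun i a b hi => hα i k j a c b d hi hcd, fun h' => absurd h' h⟩
  choose τ hτ hz using key
  exact ⟨τ, fun i j => hτ j i, hz⟩

/-- Every `E`-preserving partial transformation has a unique preimage under `φ`
in canonical form (where `τ j = 0` whenever `f j = ∅`, 0-indexed). -/
theorem stmt6 (n m : ℕ) (hn : 2 ≤ n) (hm : 2 ≤ m)
    (α : PT (Fin n × Fin m)) (hα : PreservesE n m α) :
    ∃! w : (Fin m → PT (Fin n)) × (Fin m → Fin m),
      phi n m w.1 w.2 = α ∧
        ∀ j, w.1 j = PT.empty (Fin n) → w.2 j = (⟨0, by omega⟩ : Fin m) := by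
  obtain ⟨τ, hτ, hz⟩ := hα.exists_classMap ⟨0, by omega⟩
  have hphi : phi n m (fun j i => (α (i, j)).map Prod.fst) τ = α := by
    funext ⟨i, j⟩
    rcases h : α (i, j) with _ | ⟨a, b⟩
    · simp [phi, h]
    · simp [phi, h, hτ i j a b h]
  refine ⟨(fun j i => (α (i, j)).map Prod.fst, τ), ⟨hphi, fun j hj => hz j fun i => ?_⟩, ?_⟩
  · exact Option.map_eq_none_iff.mp (congrFun hj i)
  · rintro ⟨g, σ⟩ ⟨hg, hσ⟩
    obtain rfl : g = fun j i => (α (i, j)).map Prod.fst := by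
      funext j i
      rw [← hg, map_fst_phi]
    refine Prod.ext rfl (funext fun j => ?_)
    by_cases hj : (fun i => (α (i, j)).map Prod.fst) = PT.empty (Fin n)
    · exact (hσ j hj).trans (hz j fun i => Option.map_eq_none_iff.mp (congrFun hj i)).symm
    · exact phi_snd_injective (hg.trans hphi.symm) hj
end

section
/- Let n, m ≥ 2. The rank of the monoid PT_{n×m} of E-preserving partial transformations of Fin n × Fin m equals 5: there is a subset X of PT_{n×m} with |X| = 5 whose generated submonoid is all of PT_{n×m}, and no subset of cardinality at most 4 generates PT_{n×m}. -/
namespace PT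

open Equiv

variable {A B : Type}

instance [Finite A] : Finite (PT A) := inferInstanceAs (Finite (A → Option A))

theorem mul_apply (f g : PT A) (x : A) : (f * g) x = (f x).bind g := rfl

@[simp]
theorem some_bind (x : A) (g : PT A) : (some x).bind g = g x := rfl

@[simp]
theorem none_bind (g : PT A) : none.bind g = none := rfl

theorem mul_apply_eq_some_iff {f g : PT A} {x z : A} :
    (f * g) x = some z ↔ ∃ y, f x = some y ∧ g y = some z := by
  rw [mul_apply]
  cases f x <;> simp

theorem one_apply (x : A) : (1 : PT A) x = some x := rfl

@[ext]
theorem ext {f g : PT A} (h : ∀ x, f x = g x) : f = g := funext h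

/-- The permutation `p⁻¹` seen as a partial transformation. The inverse makes this a homomorphism,
since `PT A` composes from left to right. -/
def ofPerm : Perm A →* PT A where
  toFun p x := some (p⁻¹ x)
  map_one' := rfl
  map_mul' _ _ := rfl

theorem ofPerm_apply (p : Perm A) (x : A) : ofPerm p x = some (p⁻¹ x) := rfl

/-- A transformation seen as a partial transformation. -/
def ofFun (f : A → A) : PT A := fun x => some (f x)

theorem ofFun_apply (f : A → A) (x : A) : ofFun f x = some (f x) := rfl

/-- The idempotent sending `a` to `b` and fixing every other point. -/
def collapse [DecidableEq A] (a b : A) : PT A := fun x => some (if x = a then b else x)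

/-- The identity with `a` removed from its domain. -/
def remove [DecidableEq A] (a : A) : PT A := fun x => if x = a then none else some x

/-- The transformation of `A × B` acting as `φ b` on the block `A × {b}`. -/
def fibers : (B → PT A) →* PT (A × B) where
  toFun φ x := (φ x.2 x.1).map (·, x.2)
  map_one' := rfl
  map_mul' φ ψ := by
    funext x
    change ((φ x.2 x.1).bind (ψ x.2)).map _ = ((φ x.2 x.1).map _).bind _
    cases φ x.2 x.1 <;> rfl

/-- The transformation of `A × B` moving blocks by `g` and fixing the first coordinate. -/
def blocks : PT B →* PT (A × B) where
  toFun g x := (g x.2).map (x.1, ·)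
  map_one' := rfl
  map_mul' f g := by
    funext x
    change ((f x.2).bind g).map _ = ((f x.2).map _).bind _
    cases f x.2 <;> rfl

/-- The transformation of `A × B` acting as a given one on the block `A × {b}` and fixing
every point outside that block. -/
def fiber [DecidableEq B] (b : B) : PT A →* PT (A × B) :=
  fibers.comp (MonoidHom.mulSingle (fun _ => PT A) b)

theorem fibers_apply (φ : B → PT A) (x : A × B) : fibers φ x = (φ x.2 x.1).map (·, x.2) := rfl

theorem blocks_apply (g : PT B) (x : A × B) : blocks g x = (g x.2).map (x.1, ·) := rfl

theorem fiber_apply [DecidableEq B] (b : B) (f : PT A) (x : A × B) :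
    fiber b f x = if x.2 = b then (f x.1).map (·, x.2) else some x := by
  obtain ⟨i, j⟩ := x
  by_cases h : j = b
  · subst h; simp [fiber, fibers_apply]
  · simp [fiber, fibers_apply, h, one_apply]

theorem blocks_ofPerm_mul_fiber [DecidableEq B] (p : Perm B) (b : B) (f : PT A) :
    blocks (ofPerm p) * fiber b f = fiber (p b) f * blocks (ofPerm p) := by
  ext1 x
  obtain ⟨i, j⟩ := x
  have key : p.symm j = b ↔ j = p b := p.symm_apply_eq
  by_cases h : j = p b
  · subst h
    cases hf : f i <;> simp [mul_apply, blocks_apply, fiber_apply, ofPerm_apply, hf]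
  · simp [mul_apply, blocks_apply, fiber_apply, ofPerm_apply, key, h]

theorem exists_eq_fibers_mul_blocks (α : PT (A × B))
    (hα : ∀ x y u v, x.2 = y.2 → α x = some u → α y = some v → u.2 = v.2) :
    ∃ (φ : B → PT A) (g : B → B), α = fibers φ * blocks (ofFun g) := by
  have hex (b : B) : ∃ c, ∀ a v, α (a, b) = some v → v.2 = c := by
    by_cases h : ∃ a v, α (a, b) = some v
    · obtain ⟨a, v, hv⟩ := h
      exact ⟨v.2, fun a' v' hv' => hα (a', b) (a, b) v' v rfl hv' hv⟩
    · exact ⟨b, fun a v hv => absurd ⟨a, v, hv⟩ h⟩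
  choose g hg using hex
  let φ (b : B) : PT A := fun a => (α (a, b)).map Prod.fst
  have hφ (a : A) (b : B) : φ b a = (α (a, b)).map Prod.fst := rfl
  refine ⟨φ, g, ext fun ⟨a, b⟩ => ?_⟩
  cases h : α (a, b) with
  | none => simp [mul_apply, fibers_apply, hφ, h]
  | some v => simp [mul_apply, fibers_apply, hφ, h, blocks_apply, ofFun_apply, ← hg b a v h]

section Generation

variable [DecidableEq A]

theorem exists_perm_apply_eq {a b c d : A} (hab : a ≠ b) (hcd : c ≠ d) :
    ∃ p : Perm A, p a = c ∧ p b = d := by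
  refine ⟨swap (swap a c b) d * swap a c, ?_, by simp⟩
  have : c ≠ swap a c b := fun h => hab (by simpa using congrArg (swap a c) h)
  simp [swap_apply_of_ne_of_ne this hcd]

theorem ofPerm_conj_collapse (p : Perm A) (a b : A) :
    ofPerm p * collapse a b * ofPerm p⁻¹ = collapse (p a) (p b) := by
  ext1 x
  have key : p.symm x = a ↔ x = p a := p.symm_apply_eq
  by_cases h : x = p a <;> simp [mul_apply, ofPerm_apply, collapse, key, h]

theorem ofPerm_conj_remove (p : Perm A) (a : A) :
    ofPerm p * remove a * ofPerm p⁻¹ = remove (p a) := by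
  ext1 x
  have key : p.symm x = a ↔ x = p a := p.symm_apply_eq
  by_cases h : x = p a <;> simp [mul_apply, ofPerm_apply, remove, key, h]

theorem total_mem_of_collapse_mem [Finite A] {M : Submonoid (PT A)} (hM : ∀ p, ofPerm p ∈ M)
    {a b : A} (hab : a ≠ b) (hc : collapse a b ∈ M) (f : A → A) : ofFun f ∈ M := by
  have hcol {c d : A} (hcd : c ≠ d) : collapse c d ∈ M := by
    obtain ⟨p, rfl, rfl⟩ := exists_perm_apply_eq hab hcd
    rw [← ofPerm_conj_collapse]
    exact M.mul_mem (M.mul_mem (hM _) hc) (hM _)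
  induction hk : (Set.range f)ᶜ.ncard using Nat.strong_induction_on generalizing f with
  | _ k ih =>
    by_cases hf : Function.Injective f
    · have := hM (Equiv.ofBijective f (Finite.injective_iff_bijective.mp hf))⁻¹
      exact this
    · have hsurj : ¬ Function.Surjective f := fun h => hf (Finite.injective_iff_surjective.mpr h)
      simp only [Function.Injective, Function.Surjective, not_forall, not_exists] at hf hsurj
      obtain ⟨x, y, hxy, hne⟩ := hf
      obtain ⟨z, hz⟩ := hsurj
      have hlt : (Set.range (Function.update f x z))ᶜ.ncard < k := by
        rw [← hk]
        refine Set.ncard_lt_ncard ⟨?_, fun h => ?_⟩ (Set.toFinite _)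
        · refine Set.compl_subset_compl.mpr ?_
          rintro _ ⟨w, rfl⟩
          by_cases hw : w = x
          · exact ⟨y, by simp [Function.update_of_ne (Ne.symm hne), hw, hxy]⟩
          · exact ⟨w, by simp [hw]⟩
        · exact h (show z ∈ (Set.range f)ᶜ by simpa using hz) ⟨x, by simp⟩
      have := M.mul_mem (ih _ hlt _ rfl) (hcol (fun h => hz x h.symm : z ≠ f x))
      refine cast (congrArg (· ∈ M) (ext fun w => ?_)) this
      by_cases hw : w = x
      · subst hw; simp [mul_apply, ofFun_apply, collapse]
      · simp [mul_apply, ofFun_apply, collapse, hw, hz w]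

theorem eq_top_of_collapse_mem_of_remove_mem [Finite A] {M : Submonoid (PT A)}
    (hM : ∀ p, ofPerm p ∈ M) {a b : A} (hab : a ≠ b) (hc : collapse a b ∈ M)
    (hr : remove a ∈ M) : M = ⊤ := by
  have hrem (c : A) : remove c ∈ M := by
    have := M.mul_mem (M.mul_mem (hM (swap a c)) hr) (hM (swap a c)⁻¹)
    rwa [ofPerm_conj_remove, swap_apply_left] at this
  refine (Submonoid.eq_top_iff' M).mpr fun f => ?_
  induction hk : {x | f x = none}.ncard using Nat.strong_induction_on generalizing f with
  | _ k ih =>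
    by_cases hf : ∃ x, f x = none
    · obtain ⟨x, hx⟩ := hf
      let f' : PT A := fun y => if y = x then some x else f y
      have hf' (y : A) : f' y = if y = x then some x else f y := rfl
      have hlt : {y | f' y = none}.ncard < k := by
        rw [← hk]
        refine Set.ncard_lt_ncard ⟨fun y hy => ?_, fun h => ?_⟩ (Set.toFinite _)
        · by_cases hyx : y = x
          · exact hyx ▸ hx
          · simpa [hf', hyx] using hy
        · simpa [hf'] using h hx
      have := M.mul_mem (hrem x) (ih _ hlt f' rfl)
      refine cast (congrArg (· ∈ M) (ext fun w => ?_)) this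
      by_cases hw : w = x
      · subst hw; simp [mul_apply, remove, hx]
      · simp [mul_apply, remove, hw, hf']
    · simp only [not_exists, ← ne_eq, Option.ne_none_iff_exists'] at hf
      choose g hg using hf
      rw [show f = ofFun g from funext hg]
      exact total_mem_of_collapse_mem hM hab hc g

end Generation

end PT

namespace Equiv.Perm

theorem exists_odd_pow_eq_one_closure_swap_eq_top (n : ℕ) :
    ∃ (w : Perm (Fin (n + 2))) (r : ℕ), Odd r ∧ w ^ r = 1 ∧
      Subgroup.closure {swap 0 1, w} = ⊤ := by
  have hgen := closure_cycle_adjacent_swap (isCycle_finRotate (n := n)) support_finRotate 0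
  rw [finRotate_apply, zero_add] at hgen
  rcases Nat.even_or_odd n with hn | hn
  · refine ⟨swap 0 1 * finRotate (n + 2), n + 1, hn.add_one, ?_, ?_⟩
    · rcases Nat.eq_zero_or_pos n with rfl | hpos
      · decide
      · have h0 : finRotate (n + 2) 0 = 1 := by rw [finRotate_apply, zero_add]
        have h1 : finRotate (n + 2) (finRotate (n + 2) 0) ≠ 0 := by
          rw [h0, finRotate_apply, Ne, Fin.ext_iff, Fin.val_add]
          simp [Nat.mod_eq_of_lt (show 1 + 1 < n + 2 by omega)]
        have hcyc := isCycle_finRotate.swap_mul (x := (0 : Fin (n + 2))) (by simp [h0]) h1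
        have hord := hcyc.orderOf
        rw [support_swap_mul_eq _ _ h1, support_finRotate, h0, Finset.card_univ_sdiff] at hord
        simp only [Fintype.card_fin, Finset.card_singleton] at hord
        exact orderOf_dvd_iff_pow_eq_one.mp (dvd_of_eq hord)
    · rw [eq_top_iff, ← hgen, Subgroup.closure_le]
      have hs : swap 0 1 ∈ Subgroup.closure {swap 0 1, swap 0 1 * finRotate (n + 2)} :=
        Subgroup.subset_closure (by simp)
      have hw : swap 0 1 * finRotate (n + 2) ∈
          Subgroup.closure {swap 0 1, swap 0 1 * finRotate (n + 2)} :=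
        Subgroup.subset_closure (by simp)
      rintro _ (rfl | rfl)
      · exact ((Subgroup.mul_mem_cancel_left _ hs).mp hw)
      · exact hs
  · refine ⟨finRotate (n + 2), n + 2, by simpa [parity_simps] using hn, ?_, ?_⟩
    · have hord := (isCycle_finRotate (n := n)).orderOf
      rw [support_finRotate, Finset.card_univ, Fintype.card_fin] at hord
      exact orderOf_dvd_iff_pow_eq_one.mp (dvd_of_eq hord)
    · rwa [Set.pair_comm]

end Equiv.Perm

section WreathProduct

open Equiv

variable {G K : Type*} [Group G] [Group K]

/-- Two elements suffice to generate the complement of a wreath product by a symmetric group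
together with two elements `u`, `w` of one coordinate, if `u` is an involution and `w` has
odd order. -/
theorem exists_pair_generating_wreath (m : ℕ) (P : Perm (Fin (m + 2)) →* G)
    (F : Fin (m + 2) → K →* G) (hPF : ∀ p b k, P p * F b k = F (p b) k * P p)
    (hF : ∀ b c, b ≠ c → ∀ k l, Commute (F b k) (F c l)) {u w : K} (hu : u ^ 2 = 1) {r : ℕ}
    (hr : Odd r) (hw : w ^ r = 1) :
    ∃ x y : G, (∀ p, P p ∈ Subgroup.closure {x, y}) ∧ F 0 u ∈ Subgroup.closure {x, y} ∧
      F 0 w ∈ Subgroup.closure {x, y} ∧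
      ∀ N : Submonoid G, (∀ p, P p ∈ N) → (∀ b k, F b k ∈ N) → x ∈ N ∧ y ∈ N := by
  have pow_odd {a b : G} (hab : Commute a b) (ha : a ^ 2 = 1) (hb : b ^ r = 1) :
      (a * b) ^ r = a ∧ (a * b) ^ (r + 1) = b := by
    obtain ⟨s, rfl⟩ := hr
    constructor
    · rw [hab.mul_pow, hb, mul_one, pow_succ, pow_mul, ha, one_pow, one_mul]
    · rw [hab.mul_pow, pow_succ b, hb, one_mul, add_assoc, show 1 + 1 = 2 * 1 from rfl,
        ← mul_add, pow_mul, ha, one_pow, one_mul]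
  have conj_mem {H : Subgroup G} (hP : ∀ p, P p ∈ H) {b : Fin (m + 2)} {k : K}
      (h : F b k ∈ H) : F 0 k ∈ H := by
    have h1 := hPF (swap b 0) b k
    rw [swap_apply_left] at h1
    exact (H.mul_mem_cancel_right (hP _)).mp (h1 ▸ H.mul_mem (hP _) h)
  rcases Nat.eq_zero_or_pos m with rfl | hm
  · refine ⟨P (swap 0 1), F 0 u * F 1 w, ?_⟩
    set H := Subgroup.closure {P (swap 0 1), F 0 u * F 1 w}
    have hx : P (swap 0 1) ∈ H := Subgroup.subset_closure (by simp)
    have hy : F 0 u * F 1 w ∈ H := Subgroup.subset_closure (by simp)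
    have hP (p : Perm (Fin 2)) : P p ∈ H := by
      have : p = 1 ∨ p = swap 0 1 := by revert p; decide
      rcases this with rfl | rfl
      · rw [map_one]; exact H.one_mem
      · exact hx
    obtain ⟨e1, e2⟩ := pow_odd (hF 0 1 (by simp) u w) (by rw [← map_pow, hu, map_one])
      (by rw [← map_pow, hw, map_one])
    exact ⟨hP, e1 ▸ H.pow_mem hy r, conj_mem hP (e2 ▸ H.pow_mem hy (r + 1)),
      fun N hPN hFN => ⟨hPN _, N.mul_mem (hFN _ _) (hFN _ _)⟩⟩
  · let c : Fin (m + 2) := ⟨2, by omega⟩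
    refine ⟨F 0 u * P (finRotate (m + 2)), P (swap 0 1) * F c w, ?_⟩
    set H := Subgroup.closure {F 0 u * P (finRotate (m + 2)), P (swap 0 1) * F c w}
    have hx : F 0 u * P (finRotate (m + 2)) ∈ H := Subgroup.subset_closure (by simp)
    have hy : P (swap 0 1) * F c w ∈ H := Subgroup.subset_closure (by simp)
    have hc : swap 0 1 c = c := swap_apply_of_ne_of_ne (by simp [c, Fin.ext_iff])
      (by simp [c, Fin.ext_iff])
    have hcomm : Commute (P (swap 0 1)) (F c w) := by
      have := hPF (swap 0 1) c w
      rwa [hc] at this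
    obtain ⟨e1, e2⟩ := pow_odd hcomm (by rw [← map_pow, pow_two, swap_mul_self, map_one])
      (by rw [← map_pow, hw, map_one])
    have hadj (i : ℕ) (hi : i < m + 1) :
        P (swap (⟨i, hi⟩ : Fin (m + 1)).castSucc (⟨i, hi⟩ : Fin (m + 1)).succ) ∈ H := by
      induction i with
      | zero => exact e1 ▸ H.pow_mem hy r
      | succ i ih =>
        have h1 := H.mul_mem (H.mul_mem hx (ih (by omega))) (H.inv_mem hx)
        have hrot (j : Fin (m + 1)) : finRotate (m + 2) j.castSucc = j.succ := by
          rw [finRotate_apply, Fin.coeSucc_eq_succ]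
        have h2 : finRotate (m + 2) * swap (⟨i, by omega⟩ : Fin (m + 1)).castSucc
            (⟨i, by omega⟩ : Fin (m + 1)).succ = swap (⟨i + 1, hi⟩ : Fin (m + 1)).castSucc
            (⟨i + 1, hi⟩ : Fin (m + 1)).succ * finRotate (m + 2) := by
          rw [mul_swap_eq_swap_mul, hrot,
            ← hrot ⟨i + 1, hi⟩]
          rfl
        convert h1 using 1
        rw [eq_mul_inv_iff_mul_eq, mul_assoc (F 0 u), ← map_mul, h2, map_mul, ← mul_assoc,
          ← mul_assoc, hPF, swap_apply_of_ne_of_ne (by simp [Fin.ext_iff]) (by simp [Fin.ext_iff])]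
    have hP (p : Perm (Fin (m + 2))) : P p ∈ H := by
      have htop : (⊤ : Submonoid (Perm (Fin (m + 2)))) ≤ H.toSubmonoid.comap P := by
        rw [← Perm.mclosure_swap_castSucc_succ, Submonoid.closure_le]
        rintro _ ⟨i, rfl⟩
        exact hadj i i.2
      exact htop (Submonoid.mem_top p)
    exact ⟨hP, (H.mul_mem_cancel_right (hP _)).mp hx, conj_mem hP (e2 ▸ H.pow_mem hy (r + 1)),
      fun N hPN hFN => ⟨N.mul_mem (hFN _ _) (hPN _), N.mul_mem (hPN _) (hFN _ _)⟩⟩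

end WreathProduct

namespace PT

open Equiv

section UpperBound

variable (n m : ℕ)

/-- The submonoid of `E`-preserving partial transformations. -/
def preservesE : Submonoid (PT (Fin n × Fin m)) where
  carrier := {α | PreservesE n m α}
  one_mem' := by
    intro i k j a c b d h1 h2
    simp only [one_apply, Option.some.injEq, Prod.mk.injEq] at h1 h2
    exact h1.2.symm.trans h2.2
  mul_mem' := by
    intro f g hf hg i k j a c b d h1 h2
    simp only [mul_apply_eq_some_iff, Prod.exists] at h1 h2
    obtain ⟨a', b', h1, h1'⟩ := h1
    obtain ⟨c', d', h2, h2'⟩ := h2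
    obtain rfl := hf _ _ _ _ _ _ _ h1 h2
    exact hg _ _ _ _ _ _ _ h1' h2'

variable {n m}

theorem mem_preservesE {α : PT (Fin n × Fin m)} :
    α ∈ preservesE n m ↔
      ∀ x y u v, x.2 = y.2 → α x = some u → α y = some v → u.2 = v.2 := by
  constructor
  · rintro h ⟨i, j⟩ ⟨k, l⟩ ⟨a, b⟩ ⟨c, d⟩ hjl h1 h2
    obtain rfl : j = l := hjl
    exact h _ _ _ _ _ _ _ h1 h2
  · intro h i k j a c b d h1 h2
    exact h (i, j) (k, j) _ _ rfl h1 h2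

theorem fibers_mem_preservesE (φ : Fin m → PT (Fin n)) : fibers φ ∈ preservesE n m := by
  rw [mem_preservesE]
  intro x y u v hxy hu hv
  simp only [fibers_apply, Option.map_eq_some_iff] at hu hv
  obtain ⟨_, _, rfl⟩ := hu
  obtain ⟨_, _, rfl⟩ := hv
  exact hxy

theorem fiber_mem_preservesE (b : Fin m) (f : PT (Fin n)) : fiber b f ∈ preservesE n m :=
  fibers_mem_preservesE _

theorem blocks_mem_preservesE (g : PT (Fin m)) : blocks g ∈ preservesE n m := by
  rw [mem_preservesE]
  intro x y u v hxy hu hv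
  simp only [blocks_apply, Option.map_eq_some_iff, hxy] at hu hv
  obtain ⟨_, h1, rfl⟩ := hu
  obtain ⟨_, h2, rfl⟩ := hv
  simpa [h1] using h2

theorem preservesE_le {M : Submonoid (PT (Fin n × Fin m))} {b : Fin m}
    (hfib : ∀ f, fiber b f ∈ M) (hblk : ∀ g : Fin m → Fin m, blocks (ofFun g) ∈ M) :
    preservesE n m ≤ M := by
  intro α hα
  obtain ⟨φ, g, rfl⟩ := exists_eq_fibers_mul_blocks α (mem_preservesE.mp hα)
  refine M.mul_mem ?_ (hblk g)
  refine Submonoid.pi_mem_of_mulSingle_mem (H := M.comap fibers) φ fun j => ?_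
  have hperm (p : Perm (Fin m)) : blocks (ofPerm p) ∈ M := hblk fun j => p⁻¹ j
  have h1 : fiber j (φ j) =
      blocks (ofPerm (swap b j)) * fiber b (φ j) * blocks (ofPerm (swap b j)) := by
    rw [blocks_ofPerm_mul_fiber, mul_assoc, ← map_mul, ← map_mul, swap_mul_self, map_one,
      map_one, mul_one, swap_apply_left]
  change fiber j (φ j) ∈ M
  rw [h1]
  exact M.mul_mem (M.mul_mem (hperm _) (hfib _)) (hperm _)

theorem exists_pair_generating_units (n m : ℕ) :
    ∃ x y : PT (Fin (n + 2) × Fin (m + 2)), x ∈ preservesE _ _ ∧ y ∈ preservesE _ _ ∧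
      ∀ M : Submonoid (PT (Fin (n + 2) × Fin (m + 2))), x ∈ M → y ∈ M →
        (∀ p, blocks (ofPerm p) ∈ M) ∧ ∀ p, fiber 0 (ofPerm p) ∈ M := by
  obtain ⟨w, r, hr, hw, htop⟩ := Perm.exists_odd_pow_eq_one_closure_swap_eq_top n
  let P : Perm (Fin (m + 2)) →* (PT (Fin (n + 2) × Fin (m + 2)))ˣ :=
    (blocks.comp ofPerm).toHomUnits
  let F (b : Fin (m + 2)) : Perm (Fin (n + 2)) →* (PT (Fin (n + 2) × Fin (m + 2)))ˣ :=
    ((fiber b).comp ofPerm).toHomUnits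
  obtain ⟨x, y, hP, hu, hw, hN⟩ := exists_pair_generating_wreath m P F
    (fun p b k => Units.ext (blocks_ofPerm_mul_fiber p b (ofPerm k)))
    (fun b c hbc k l => Units.ext
      ((Pi.mulSingle_commute hbc (ofPerm k) (ofPerm l)).map fibers).eq)
    (u := swap 0 1) (by rw [pow_two, swap_mul_self]) hr hw
  obtain ⟨hx, hy⟩ := hN ((preservesE (n + 2) (m + 2)).comap (Units.coeHom _))
    (fun p => blocks_mem_preservesE (ofPerm p)) (fun b k => fiber_mem_preservesE b (ofPerm k))
  refine ⟨x, y, hx, hy, fun M hxM hyM => ?_⟩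
  have hle : (Subgroup.closure {x, y}).toSubmonoid ≤ M.comap (Units.coeHom _) := by
    rw [Subgroup.closure_toSubmonoid_of_finite, Submonoid.closure_le]
    rintro _ (rfl | rfl)
    exacts [hxM, hyM]
  refine ⟨fun p => hle (hP p), fun p => hle (x := F 0 p) ?_⟩
  have hle' : Subgroup.closure {swap 0 1, w} ≤ (Subgroup.closure {x, y}).comap (F 0) := by
    rw [Subgroup.closure_le]
    rintro _ (rfl | rfl)
    exacts [hu, hw]
  exact hle' (htop ▸ Subgroup.mem_top p)

theorem exists_card_le_five_closure_eq (n m : ℕ) :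
    ∃ X : Finset (PT (Fin (n + 2) × Fin (m + 2))), X.card ≤ 5 ∧
      (X : Set (PT (Fin (n + 2) × Fin (m + 2)))) ⊆ {α | PreservesE (n + 2) (m + 2) α} ∧
        ↑(Submonoid.closure (X : Set (PT (Fin (n + 2) × Fin (m + 2))))) =
          {α : PT (Fin (n + 2) × Fin (m + 2)) | PreservesE (n + 2) (m + 2) α} := by
  classical
  obtain ⟨x, y, hx, hy, hxy⟩ := exists_pair_generating_units n m
  let X : Finset (PT (Fin (n + 2) × Fin (m + 2))) :=
    {x, y, fiber 0 (collapse 0 1), fiber 0 (remove 0), blocks (collapse 0 1)}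
  have hX : (X : Set (PT (Fin (n + 2) × Fin (m + 2)))) ⊆ preservesE (n + 2) (m + 2) := by
    intro z hz
    simp only [X, Finset.coe_insert, Finset.coe_singleton, Set.mem_insert_iff,
      Set.mem_singleton_iff] at hz
    rcases hz with rfl | rfl | rfl | rfl | rfl
    exacts [hx, hy, fiber_mem_preservesE _ _, fiber_mem_preservesE _ _, blocks_mem_preservesE _]
  refine ⟨X, Finset.card_le_five, hX, ?_⟩
  refine congrArg SetLike.coe (a₂ := preservesE (n + 2) (m + 2))
    (le_antisymm (Submonoid.closure_le.mpr hX) ?_)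
  set M := Submonoid.closure (X : Set (PT (Fin (n + 2) × Fin (m + 2))))
  have hmem {z} (hz : z ∈ X) : z ∈ M := Submonoid.subset_closure hz
  obtain ⟨hblk, hfib⟩ := hxy M (hmem (by simp [X])) (hmem (by simp [X]))
  refine preservesE_le (b := 0) (fun f => ?_) fun g => ?_
  · have := eq_top_of_collapse_mem_of_remove_mem (M := M.comap (fiber 0))
      hfib zero_ne_one (hmem (z := fiber 0 (collapse 0 1)) (by simp [X]))
      (hmem (z := fiber 0 (remove 0)) (by simp [X]))
    exact (Submonoid.eq_top_iff' _).mp this f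
  · exact total_mem_of_collapse_mem (M := M.comap blocks) hblk
      zero_ne_one (hmem (z := blocks (collapse 0 1)) (by simp [X])) g

end UpperBound

section LowerBound

theorem _root_.Submonoid.exists_mem_of_mem_closure {M : Type*} [Monoid M] {X : Set M}
    {N : Submonoid M} (hX : X ⊆ N) {T : M → Prop} (h_one : ¬ T 1)
    (h_mul : ∀ f ∈ N, ∀ g ∈ N, T (f * g) → T f ∨ T g) {z : M}
    (hz : z ∈ Submonoid.closure X) (hT : T z) : ∃ x ∈ X, T x := by
  induction hz using Submonoid.closure_induction with
  | mem x hx => exact ⟨x, hx, hT⟩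
  | one => exact absurd hT h_one
  | mul f g hf hg ihf ihg =>
    have hle := Submonoid.closure_le.mpr hX
    exact (h_mul f (hle hf) g (hle hg) hT).elim ihf ihg

/-- A partial transformation is total if it is defined everywhere. -/
def IsTotal (f : PT A) : Prop := ∀ x, f x ≠ none

theorem IsTotal.left {f g : PT A} (h : IsTotal (f * g)) : IsTotal f := fun x hx =>
  h x (by rw [mul_apply, hx]; rfl)

theorem ofPerm_mul_apply (p : Perm A) (g : PT A) (x : A) : (ofPerm p * g) (p x) = g x := by
  simp [mul_apply, ofPerm_apply]

theorem isTotal_ofPerm (p : Perm A) : IsTotal (ofPerm p) := fun _ => Option.some_ne_none _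

theorem ofPerm_apply_inj {p : Perm A} {x y : A} (h : ofPerm p x = ofPerm p y) : x = y := by
  simpa [ofPerm_apply] using h

theorem mem_mrange_ofPerm [Finite A] {f : PT A} (ht : IsTotal f)
    (hi : ∀ x y, f x = f y → x = y) : f ∈ MonoidHom.mrange (ofPerm (A := A)) := by
  simp only [IsTotal, Option.ne_none_iff_exists'] at ht
  choose g hg using ht
  have hinj : Function.Injective g := fun x y h => hi x y (by rw [hg, hg, h])
  exact ⟨(Equiv.ofBijective g (Finite.injective_iff_bijective.mp hinj))⁻¹,
    ext fun x => (hg x).symm⟩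

theorem mem_mrange_ofPerm_of_mul_mem [Finite A] {f g : PT A}
    (h : f * g ∈ MonoidHom.mrange (ofPerm (A := A))) :
    f ∈ MonoidHom.mrange (ofPerm (A := A)) ∧ g ∈ MonoidHom.mrange (ofPerm (A := A)) := by
  obtain ⟨p, hp⟩ := h
  obtain ⟨q, rfl⟩ : f ∈ MonoidHom.mrange (ofPerm (A := A)) := by
    refine mem_mrange_ofPerm (IsTotal.left (hp ▸ isTotal_ofPerm p)) fun x y hxy => ?_
    exact ofPerm_apply_inj (p := p) (by rw [hp, mul_apply, mul_apply, hxy])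
  refine ⟨⟨q, rfl⟩, q⁻¹ * p, ?_⟩
  rw [map_mul, hp, ← mul_assoc, ← map_mul, inv_mul_cancel, map_one, one_mul]

/-- Permutations generated by `X` are already generated by the permutations in `X`. -/
theorem mem_closure_inter_mrange_ofPerm [Finite A] {X : Set (PT A)} {z : PT A}
    (hz : z ∈ Submonoid.closure X) (hu : z ∈ MonoidHom.mrange (ofPerm (A := A))) :
    z ∈ Submonoid.closure (X ∩ MonoidHom.mrange (ofPerm (A := A))) := by
  induction hz using Submonoid.closure_induction with
  | mem x hx => exact Submonoid.subset_closure ⟨hx, hu⟩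
  | one => exact Submonoid.one_mem _
  | mul f g _ _ ihf ihg =>
    obtain ⟨hf, hg⟩ := mem_mrange_ofPerm_of_mul_mem hu
    exact Submonoid.mul_mem _ (ihf hf) (ihg hg)

theorem ofPerm_inv_mem [Finite A] {N : Submonoid (PT A)} {p : Perm A} (hp : ofPerm p ∈ N) :
    ofPerm p⁻¹ ∈ N := by
  have h : p⁻¹ ∈ Submonoid.powers p :=
    mem_powers_iff_mem_zpowers.mpr ((Subgroup.zpowers p).inv_mem (Subgroup.mem_zpowers p))
  exact (Submonoid.powers_le (P := N.comap ofPerm)).mpr hp h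

section

variable {n m : ℕ} {X : Set (PT (Fin (n + 2) × Fin (m + 2)))}

theorem exists_injective_of_closure_eq (h : Submonoid.closure X = preservesE (n + 2) (m + 2)) :
    ∃ f ∈ X, (∀ x y, f x = f y → x = y) ∧ f ∉ MonoidHom.mrange ofPerm := by
  refine Submonoid.exists_mem_of_mem_closure (N := ⊤) (z := fiber 0 (remove 0)) (fun _ _ => trivial)
    (fun h => h.2 (one_mem _)) ?_ (h ▸ fiber_mem_preservesE _ _) ⟨?_, ?_⟩
  · rintro f - g - ⟨hi, hu⟩
    by_cases hf : f ∈ MonoidHom.mrange ofPerm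
    · refine Or.inr ⟨fun x y hxy => ?_, fun hg => hu (mul_mem hf hg)⟩
      obtain ⟨p, rfl⟩ := hf
      exact p.injective (hi _ _ (by rw [ofPerm_mul_apply, ofPerm_mul_apply, hxy]))
    · exact Or.inl ⟨fun x y hxy => hi x y (by rw [mul_apply, mul_apply, hxy]), hf⟩
  · rintro ⟨i, j⟩ ⟨k, l⟩ hxy
    simp only [fiber_apply, remove] at hxy
    grind
  · rintro ⟨p, hp⟩
    exact isTotal_ofPerm p (0, 0) (by rw [hp, fiber_apply]; simp [remove])

theorem exists_blockFaithful_of_closure_eq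
    (h : Submonoid.closure X = preservesE (n + 2) (m + 2)) :
    ∃ f ∈ X, IsTotal f ∧
      (∀ x y u v, f x = some u → f y = some v → u.2 = v.2 → x.2 = y.2) ∧
        f ∉ MonoidHom.mrange ofPerm := by
  refine Submonoid.exists_mem_of_mem_closure (N := preservesE (n + 2) (m + 2))
    (z := fiber 0 (collapse 0 1)) (h ▸ Submonoid.subset_closure)
    (fun h => h.2.2 (one_mem _)) ?_ (h ▸ fiber_mem_preservesE _ _) ⟨?_, ?_, ?_⟩
  · rintro f hfN g hgN ⟨ht, hi, hu⟩
    by_cases hf : f ∈ MonoidHom.mrange ofPerm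
    · refine Or.inr ⟨fun x hx => ?_, fun x y u v hx hy huv => ?_, fun hg => hu (mul_mem hf hg)⟩
      · obtain ⟨p, rfl⟩ := hf
        exact ht (p x) (by rw [ofPerm_mul_apply, hx])
      · obtain ⟨p, rfl⟩ := hf
        have hxy := hi (p x) (p y) u v (by rw [ofPerm_mul_apply, hx])
          (by rw [ofPerm_mul_apply, hy]) huv
        exact mem_preservesE.mp hfN _ _ x y hxy (by simp [ofPerm_apply]) (by simp [ofPerm_apply])
    · refine Or.inl ⟨ht.left, fun x y u v hx hy huv => ?_, hf⟩
      obtain ⟨u', hu'⟩ := Option.ne_none_iff_exists'.mp (ht x)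
      obtain ⟨v', hv'⟩ := Option.ne_none_iff_exists'.mp (ht y)
      refine hi x y u' v' hu' hv' (mem_preservesE.mp hgN u v u' v' huv ?_ ?_)
      · rwa [mul_apply, hx] at hu'
      · rwa [mul_apply, hy] at hv'
  · rintro ⟨i, j⟩ hx
    simp only [fiber_apply, collapse] at hx
    grind
  · rintro ⟨i, j⟩ ⟨k, l⟩ u v hx hy huv
    simp only [fiber_apply, collapse] at hx hy
    grind
  · rintro ⟨p, hp⟩
    have := ofPerm_apply_inj (p := p) (x := (0, 0)) (y := (1, 0))
      (by simp [hp, fiber_apply, collapse])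
    simp at this

theorem exists_blockInjective_of_closure_eq
    (h : Submonoid.closure X = preservesE (n + 2) (m + 2)) :
    ∃ f ∈ X, IsTotal f ∧ (∀ x y, x.2 = y.2 → f x = f y → x = y) ∧
      f ∉ MonoidHom.mrange ofPerm := by
  refine Submonoid.exists_mem_of_mem_closure (N := preservesE (n + 2) (m + 2))
    (z := blocks (collapse 0 1)) (h ▸ Submonoid.subset_closure)
    (fun h => h.2.2 (one_mem _)) ?_ (h ▸ blocks_mem_preservesE _) ⟨?_, ?_, ?_⟩
  · rintro f hfN g hgN ⟨ht, hi, hu⟩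
    by_cases hf : f ∈ MonoidHom.mrange ofPerm
    · refine Or.inr ⟨fun x hx => ?_, fun x y hxy hg => ?_, fun hg => hu (mul_mem hf hg)⟩
      · obtain ⟨p, rfl⟩ := hf
        exact ht (p x) (by rw [ofPerm_mul_apply, hx])
      · obtain ⟨p, rfl⟩ := hf
        have hp : (p x).2 = (p y).2 := mem_preservesE.mp (ofPerm_inv_mem hfN) x y _ _ hxy
          (by simp [ofPerm_apply]) (by simp [ofPerm_apply])
        exact p.injective (hi _ _ hp (by rw [ofPerm_mul_apply, ofPerm_mul_apply, hg]))
    · exact Or.inl ⟨ht.left, fun x y hxy hfx => hi x y hxy (by rw [mul_apply, mul_apply, hfx]), hf⟩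
  · rintro ⟨i, j⟩ hx
    simp [blocks_apply, collapse] at hx
  · rintro ⟨i, j⟩ ⟨k, l⟩ hxy hx
    simp only [blocks_apply, collapse] at hxy hx
    grind
  · rintro ⟨p, hp⟩
    have := ofPerm_apply_inj (p := p) (x := (0, 0)) (y := (0, 1))
      (by simp [hp, blocks_apply, collapse])
    simp at this

theorem not_inter_mrange_subset_singleton
    (h : Submonoid.closure X = preservesE (n + 2) (m + 2)) (g : PT (Fin (n + 2) × Fin (m + 2))) :
    ¬ X ∩ MonoidHom.mrange (ofPerm (A := Fin (n + 2) × Fin (m + 2))) ⊆ {g} := by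
  intro hg
  have hpow {z : PT (Fin (n + 2) × Fin (m + 2))} (hz : z ∈ preservesE (n + 2) (m + 2))
      (hu : z ∈ MonoidHom.mrange ofPerm) : ∃ k : ℕ, g ^ k = z := by
    rw [← h] at hz
    have := Submonoid.closure_mono hg (mem_closure_inter_mrange_ofPerm hz hu)
    rwa [Submonoid.mem_closure_singleton] at this
  have hsq : fiber (0 : Fin (m + 2)) (ofPerm (swap (0 : Fin (n + 2)) 1)) ∈
      MonoidHom.mrange (ofPerm (A := Fin (n + 2) × Fin (m + 2))) := by
    refine (mem_mrange_ofPerm_of_mul_mem 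
      (g := fiber (0 : Fin (m + 2)) (ofPerm (swap (0 : Fin (n + 2)) 1))) ?_).1
    rw [← map_mul, ← map_mul, swap_mul_self, map_one, map_one]
    exact one_mem _
  have hsq' : blocks (ofPerm (swap (0 : Fin (m + 2)) 1)) ∈
      MonoidHom.mrange (ofPerm (A := Fin (n + 2) × Fin (m + 2))) := by
    refine (mem_mrange_ofPerm_of_mul_mem (g := blocks (ofPerm (swap (0 : Fin (m + 2)) 1))) ?_).1
    rw [← map_mul, ← map_mul, swap_mul_self, map_one, map_one]
    exact one_mem _
  obtain ⟨k, hk⟩ := hpow (fiber_mem_preservesE _ _) hsq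
  obtain ⟨l, hl⟩ := hpow (blocks_mem_preservesE _) hsq'
  have hcomm := congrFun ((Commute.pow_pow_self g k l).eq) (0, 0)
  rw [hk, hl] at hcomm
  simp [mul_apply, fiber_apply, blocks_apply, ofPerm_apply] at hcomm

end

theorem five_le_card_of_closure_eq {n m : ℕ} (X : Finset (PT (Fin (n + 2) × Fin (m + 2))))
    (hgen : ↑(Submonoid.closure (X : Set (PT (Fin (n + 2) × Fin (m + 2))))) =
      {α : PT (Fin (n + 2) × Fin (m + 2)) | PreservesE (n + 2) (m + 2) α}) :
    5 ≤ X.card := by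
  classical
  have h : Submonoid.closure (X : Set (PT (Fin (n + 2) × Fin (m + 2)))) =
      preservesE (n + 2) (m + 2) := SetLike.coe_injective hgen
  obtain ⟨a, haX, hat, ha, hau⟩ := exists_blockFaithful_of_closure_eq h
  obtain ⟨b, hbX, hbt, hb, hbu⟩ := exists_blockInjective_of_closure_eq h
  obtain ⟨c, hcX, hc, hcu⟩ := exists_injective_of_closure_eq h
  have hct : ¬ IsTotal c := fun ht => hcu (mem_mrange_ofPerm ht hc)
  have hab : a ≠ b := by
    rintro rfl
    refine hau (mem_mrange_ofPerm hat fun x y hxy => hb x y ?_ hxy)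
    obtain ⟨u, hu⟩ := Option.ne_none_iff_exists'.mp (hat x)
    exact ha x y u u hu (hxy ▸ hu) rfl
  have hac : a ≠ c := fun e => hct (e ▸ hat)
  have hbc : b ≠ c := fun e => hct (e ▸ hbt)
  let U := X.filter (· ∈ MonoidHom.mrange ofPerm)
  have hU : 1 < U.card := by
    by_contra hle
    obtain ⟨g, hg⟩ := Finset.card_le_one_iff_subset_singleton.mp (not_lt.mp hle)
    refine not_inter_mrange_subset_singleton h g fun z hz => ?_
    simpa using hg (Finset.mem_filter.mpr hz)
  have hsub : insert a (insert b (insert c U)) ⊆ X := by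
    intro z hz
    simp only [Finset.mem_insert, U, Finset.mem_filter] at hz
    rcases hz with rfl | rfl | rfl | hz
    exacts [haX, hbX, hcX, hz.1]
  have hcard := Finset.card_le_card hsub
  have hmU {z} (hz : z ∉ MonoidHom.mrange ofPerm) : z ∉ U := fun h => hz (Finset.mem_filter.mp h).2
  rw [Finset.card_insert_of_notMem (by simp [hab, hac, hmU hau]),
    Finset.card_insert_of_notMem (by simp [hbc, hmU hbu]),
    Finset.card_insert_of_notMem (hmU hcu)] at hcard
  omega

end LowerBound

end PT

/-- The rank of `PT_{n×m}` is 5: some subset of `PT_{n×m}` of cardinality 5 generates it,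
and no subset of cardinality at most 4 does. -/
theorem stmt7 (n m : ℕ) (hn : 2 ≤ n) (hm : 2 ≤ m) :
    (∃ X : Finset (PT (Fin n × Fin m)),
        X.card = 5 ∧ (X : Set (PT (Fin n × Fin m))) ⊆ {α | PreservesE n m α} ∧
          ↑(Submonoid.closure (X : Set (PT (Fin n × Fin m)))) =
            {α : PT (Fin n × Fin m) | PreservesE n m α}) ∧
      ∀ X : Finset (PT (Fin n × Fin m)), X.card ≤ 4 →
        (X : Set (PT (Fin n × Fin m))) ⊆ {α | PreservesE n m α} →
          ↑(Submonoid.closure (X : Set (PT (Fin n × Fin m)))) ≠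
            {α : PT (Fin n × Fin m) | PreservesE n m α} := by
  obtain ⟨n, rfl⟩ := Nat.exists_eq_add_of_le' hn
  obtain ⟨m, rfl⟩ := Nat.exists_eq_add_of_le' hm
  refine ⟨?_, fun X hX _ hgen => ?_⟩
  · obtain ⟨X, hX, hXN, hgen⟩ := PT.exists_card_le_five_closure_eq n m
    exact ⟨X, le_antisymm hX (PT.five_le_card_of_closure_eq X hgen), hXN, hgen⟩
  · have := PT.five_le_card_of_closure_eq X hgen
    omega
end

section
/- Let n, m ≥ 2. The subgroup S_{n×m} of E-preserving permutations of Fin n × Fin m is generated by the two permutations ξ1 and ξ2; moreover no single element generates S_{n×m}, so the least cardinality of a generating set of the group S_{n×m} is 2. -/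
/-- The permutation `s̄` of `Fin m` (0-indexed): the cycle `(2 3 ⋯ m)` if both `m`
and `n` are even, and the cycle `(1 2 ⋯ m)` otherwise. -/
def sbar (n m : ℕ) (hm : 2 ≤ m) : Equiv.Perm (Fin m) :=
  if Even m ∧ Even n then
    (finRotate m).trans (Equiv.swap (⟨0, by omega⟩ : Fin m) ⟨1, by omega⟩)
  else finRotate m

/-- The permutation `ξ1` of `Fin n × Fin m` (all 0-indexed): it sends
`(i,1) ↦ ((0 1)i, s̄ 1)` and `(i,j) ↦ (i, s̄ j)` for `j ≠ 1`. -/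
def xi1 (n m : ℕ) (hn : 2 ≤ n) (hm : 2 ≤ m) : Equiv.Perm (Fin n × Fin m) :=
  (Equiv.prodComm (Fin n) (Fin m)).trans
    ((Equiv.prodShear (sbar n m hm)
        (fun j => if j = (⟨1, by omega⟩ : Fin m) then
            Equiv.swap (⟨0, by omega⟩ : Fin n) ⟨1, by omega⟩
          else Equiv.refl (Fin n))).trans
      (Equiv.prodComm (Fin m) (Fin n)))

/-- The permutation `ξ2` of `Fin n × Fin m` (all 0-indexed): it sends
`(i,0) ↦ ((0 1 ⋯ n-1)i, 1)`, `(i,1) ↦ (i,0)`, and fixes `(i,j)` for `j ≥ 2`. -/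
def xi2 (n m : ℕ) (hn : 2 ≤ n) (hm : 2 ≤ m) : Equiv.Perm (Fin n × Fin m) :=
  (Equiv.prodComm (Fin n) (Fin m)).trans
    ((Equiv.prodShear (Equiv.swap (⟨0, by omega⟩ : Fin m) ⟨1, by omega⟩)
        (fun j => if j = (⟨0, by omega⟩ : Fin m) then finRotate n else Equiv.refl (Fin n))).trans
      (Equiv.prodComm (Fin m) (Fin n)))

open Equiv Equiv.Perm

/-- The group of permutations of `α × β` that permute the fibres of the second projection. -/
def fibrePerms (α β : Type*) : Subgroup (Perm (α × β)) where
  carrier := {π | ∃ σ : Perm β, ∀ p, (π p).2 = σ p.2}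
  one_mem' := ⟨1, fun _ => rfl⟩
  mul_mem' := by
    rintro a b ⟨σ, hσ⟩ ⟨τ, hτ⟩
    exact ⟨σ * τ, fun p => by simp [hσ, hτ]⟩
  inv_mem' := by
    rintro a ⟨σ, hσ⟩
    refine ⟨σ⁻¹, fun p => ?_⟩
    rw [eq_inv_iff_eq, ← hσ, Perm.inv_def, Equiv.apply_symm_apply]

theorem coe_fibrePerms {α β : Type*} [Nonempty α] [Finite β] :
    (fibrePerms α β : Set (Perm (α × β))) =
      {π | ∀ (i k : α) (j : β), (π (i, j)).2 = (π (k, j)).2} := by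
  ext π
  constructor
  · rintro ⟨σ, hσ⟩ i k j
    simp [hσ]
  · intro h
    obtain ⟨a⟩ := ‹Nonempty α›
    have hsurj : Function.Surjective fun j => (π (a, j)).2 := fun b =>
      ⟨(π⁻¹ (a, b)).2, by
        change (π (a, (π⁻¹ (a, b)).2)).2 = b
        rw [h a (π⁻¹ (a, b)).1, Prod.mk.eta, Perm.inv_def, Equiv.apply_symm_apply]⟩
    exact ⟨Equiv.ofBijective _ (Finite.injective_iff_bijective.1
      (Finite.injective_iff_surjective.2 hsurj)), fun p => h p.1 a p.2⟩

/-- The permutation of `α × β` acting on the fibre over `j` by `f j`. -/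
def fibrewise (α β : Type*) : (β → Perm α) →* Perm (α × β) where
  toFun f :=
    { toFun := fun p => (f p.2 p.1, p.2)
      invFun := fun p => ((f p.2)⁻¹ p.1, p.2)
      left_inv := fun p => by simp
      right_inv := fun p => by simp }
  map_one' := rfl
  map_mul' _ _ := rfl

theorem fibrewise_apply {α β : Type*} (f : β → Perm α) (i : α) (j : β) :
    fibrewise α β f (i, j) = (f j i, j) := rfl

theorem fibrewise_mem_fibrePerms {α β : Type*} (f : β → Perm α) :
    fibrewise α β f ∈ fibrePerms α β := ⟨1, fun _ => rfl⟩

theorem exists_fibrewise_eq {α β : Type*} {π : Perm (α × β)} (h : ∀ p, (π p).2 = p.2) :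
    ∃ f, fibrewise α β f = π := by
  have h' : ∀ p, (π⁻¹ p).2 = p.2 := fun p => by rw [← h (π⁻¹ p), Perm.inv_def, Equiv.apply_symm_apply]
  refine ⟨fun j =>
    { toFun := fun i => (π (i, j)).1
      invFun := fun i => (π⁻¹ (i, j)).1
      left_inv := fun i => ?_
      right_inv := fun i => ?_ }, ?_⟩
  · have : ((π (i, j)).1, j) = π (i, j) := Prod.ext rfl (h (i, j)).symm
    simp [this]
  · have : ((π⁻¹ (i, j)).1, j) = π⁻¹ (i, j) := Prod.ext rfl (h' (i, j)).symm
    dsimp only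
    rw [this, Perm.inv_def, Equiv.apply_symm_apply]
  · ext ⟨i, j⟩
    · rfl
    · simp [fibrewise_apply, h]

/-- A subgroup that permutes the fibres in all possible ways and contains all permutations
supported on one fibre contains all fibre permutations. -/
theorem fibrePerms_le {α β : Type*} [Finite β] [DecidableEq β] {H : Subgroup (Perm (α × β))}
    (hH : ∀ σ : Perm β, ∃ h ∈ H, ∀ p, (h p).2 = σ p.2) (b : β)
    (hb : ∀ g, fibrewise α β (Pi.mulSingle b g) ∈ H) : fibrePerms α β ≤ H := by
  have hker : ∀ π : Perm (α × β), (∀ p, (π p).2 = p.2) → π ∈ H := by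
    intro π hπ
    obtain ⟨f, rfl⟩ := exists_fibrewise_eq hπ
    change f ∈ H.comap (fibrewise α β)
    refine Subgroup.pi_mem_of_mulSingle_mem f fun j => ?_
    obtain ⟨h, hh, hσ⟩ := hH (swap b j)
    obtain ⟨f', hf'⟩ := exists_fibrewise_eq
      (π := h⁻¹ * fibrewise α β (Pi.mulSingle j (f j)) * h) (fun p => by
        apply (swap b j).injective
        rw [← hσ]
        simp [← hσ, fibrewise])
    have hsingle : f' = Pi.mulSingle b (f' b) := by
      funext k
      by_cases hk : k = b
      · subst hk; simp
      · rw [Pi.mulSingle_eq_of_ne hk]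
        ext i
        have hki : (h (i, k)).2 ≠ j := by
          rw [hσ]
          intro e
          exact hk ((swap b j).injective (e.trans (swap_apply_left b j).symm))
        have h1 : fibrewise α β (Pi.mulSingle j (f j)) (h (i, k)) = h (i, k) := by
          rw [← Prod.mk.eta (p := h (i, k)), fibrewise_apply, Pi.mulSingle_eq_of_ne hki]
          rfl
        have h2 := congrArg (fun π : Perm (α × β) => (π (i, k)).1) hf'
        simpa [h1, fibrewise_apply] using h2
    have hmem : fibrewise α β f' ∈ H := by rw [hsingle]; exact hb _
    rw [hf'] at hmem
    have := H.mul_mem (H.mul_mem hh hmem) (H.inv_mem hh)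
    simpa [mul_assoc] using this
  rintro π ⟨σ, hσ⟩
  obtain ⟨h, hh, hhσ⟩ := hH σ
  have := hker (h⁻¹ * π) (fun p => by
    apply σ.injective
    rw [← hhσ]
    simp [hσ])
  simpa using H.mul_mem hh this

/-- If `y` shifts the fibres `b 0, …, b L` cyclically, acting by `t` on returning to `b 0`
and trivially otherwise, then `y ^ (L + 1)` acts by `t` on each of these fibres. -/
theorem pow_apply_of_cyclic_shift {α β : Type*} {y : Perm (α × β)} {t : Perm α} {L : ℕ}
    {b : ℕ → β} (hstep : ∀ k < L, ∀ i, y (i, b k) = (i, b (k + 1)))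
    (hlast : ∀ i, y (i, b L) = (t i, b 0)) {k : ℕ} (hk : k ≤ L) (i : α) :
    (y ^ (L + 1)) (i, b k) = (t i, b k) := by
  have hpow : ∀ k ≤ L, ∀ i, (y ^ k) (i, b 0) = (i, b k) := by
    intro k
    induction k with
    | zero => intros; rfl
    | succ k ih =>
      intro hk i
      rw [pow_succ', mul_apply, ih (by omega), hstep k (by omega)]
  rw [← hpow k hk i, ← mul_apply, ← pow_add, add_comm, pow_add, mul_apply, pow_succ' y L,
    mul_apply, hpow L le_rfl, hlast, hpow k hk]

/-- The permutations of the fibre over `b` that lie in `H` form a normal subgroup if the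
fibrewise elements of `H` act on this fibre as the full symmetric group. -/
theorem normal_comap_mulSingle {α β : Type*} [DecidableEq β] {H : Subgroup (Perm (α × β))}
    (b : β) {s : Set (Perm α)} (hs : Subgroup.closure s = ⊤)
    (h : ∀ g ∈ s, ∃ f, f b = g ∧ fibrewise α β f ∈ H) :
    (H.comap ((fibrewise α β).comp (MonoidHom.mulSingle (fun _ : β => Perm α) b))).Normal := by
  have htop : ∀ g, g ∈ (H.comap (fibrewise α β)).map (Pi.evalMonoidHom (fun _ => Perm α) b) := by
    have : Subgroup.closure s ≤
        (H.comap (fibrewise α β)).map (Pi.evalMonoidHom (fun _ => Perm α) b) := by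
      rw [Subgroup.closure_le]
      intro g hg
      obtain ⟨f, hf, hfH⟩ := h g hg
      exact ⟨f, hfH, hf⟩
    exact fun g => this (hs ▸ Subgroup.mem_top g)
  refine ⟨fun x hx g => ?_⟩
  obtain ⟨f, hf, rfl⟩ := htop g
  have hx' : fibrewise α β (Pi.mulSingle b x) ∈ H := hx
  have hconj := H.mul_mem (H.mul_mem hf hx') (H.inv_mem hf)
  rw [← map_inv, ← map_mul, ← map_mul] at hconj
  change fibrewise α β (Pi.mulSingle b (f b * x * (f b)⁻¹)) ∈ H
  convert hconj using 2
  funext j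
  by_cases hj : j = b
  · subst hj; simp
  · simp [Pi.mulSingle_eq_of_ne hj]

/-- Conjugation moves a fibrewise element acting by `t` on all fibres but the one over `j`. -/
theorem fibrewise_mem_of_conj {α β : Type*} [DecidableEq β] {H : Subgroup (Perm (α × β))}
    {h : Perm (α × β)} (hh : h ∈ H) {φ : β → Perm α} {σ : Perm β}
    (hφ : ∀ i k, h (i, k) = (φ k i, σ k)) {t : Perm α} {j : β}
    (hcomm : ∀ k ≠ j, Commute (φ k) t)
    (hj : fibrewise α β (fun k => if k = j then 1 else t) ∈ H) :
    fibrewise α β (fun k => if k = σ j then 1 else t) ∈ H := by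
  have key : h * fibrewise α β (fun k => if k = j then 1 else t) =
      fibrewise α β (fun k => if k = σ j then 1 else t) * h := by
    refine Equiv.ext fun ⟨i, k⟩ => ?_
    rw [mul_apply, mul_apply, fibrewise_apply, hφ, hφ, fibrewise_apply]
    by_cases hk : k = j
    · simp [hk]
    · have := congrArg (fun g : Perm α => g i) (hcomm k hk).eq
      simpa [hk] using this
  rw [← mul_inv_eq_iff_eq_mul] at key
  rw [← key]
  exact H.mul_mem (H.mul_mem hh hj) (H.inv_mem hh)

/-- If there is an even number of fibres, the elements acting by an involution `t` on all
fibres but one generate the elements acting by `t` on a single fibre. -/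
theorem fibrewise_mulSingle_mem {α β : Type*} [Fintype β] [DecidableEq β]
    (hβ : Even (Fintype.card β)) {H : Subgroup (Perm (α × β))} {t : Perm α} (ht : t * t = 1)
    (h : ∀ j, fibrewise α β (fun k => if k = j then 1 else t) ∈ H) (b : β) :
    fibrewise α β (Pi.mulSingle b t) ∈ H := by
  let L : AddSubgroup (β → ℤ) :=
    { carrier := {f | fibrewise α β (fun k => t ^ f k) ∈ H}
      zero_mem' := by
        change fibrewise α β 1 ∈ H
        rw [map_one]
        exact H.one_mem
      add_mem' := fun {f g} hf hg => by
        have := H.mul_mem hf hg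
        rw [← map_mul] at this
        change fibrewise α β _ ∈ H
        convert this using 2
        funext k
        simp [zpow_add]
      neg_mem' := fun {f} hf => by
        have := H.inv_mem hf
        rw [← map_inv] at this
        change fibrewise α β _ ∈ H
        convert this using 2
        funext k
        simp }
  have hL : ∀ j, (fun k => if k = j then 0 else 1) ∈ L := by
    intro j
    change fibrewise α β _ ∈ H
    convert h j using 2
    funext k
    by_cases hk : k = j <;> simp [hk]
  have hsum := L.sub_mem (L.sum_mem fun j (_ : j ∈ Finset.univ) => hL j) (hL b)
  change fibrewise α β _ ∈ H at hsum
  convert hsum using 2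
  funext k
  have hcard : (∑ j, fun k : β => if k = j then (0 : ℤ) else 1) k = (Fintype.card β : ℤ) - 1 := by
    rw [Finset.sum_apply, eq_sub_iff_add_eq]
    have : ∑ j : β, (if k = j then (1 : ℤ) else 0) = 1 := by simp
    rw [← this, ← Finset.sum_add_distrib]
    have hone : ∀ j : β, ((if k = j then (0 : ℤ) else 1) + if k = j then 1 else 0) = 1 := by
      intro j; split_ifs <;> rfl
    simp [hone]
  obtain ⟨r, hr⟩ := hβ
  have htr : t ^ ((r : ℤ) + r) = 1 := by
    rw [← two_mul, zpow_mul, zpow_two, ht, one_zpow]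
  have htinv : t⁻¹ = t := inv_eq_of_mul_eq_one_left ht
  rw [Pi.sub_apply, hcard, hr]
  by_cases hk : k = b
  · subst hk
    simp [zpow_sub, htr, htinv]
  · rw [Pi.mulSingle_eq_of_ne hk]
    simp [hk, zpow_sub, htr, htinv, ht]

section SymmetricGroup

variable {α : Type*} [Fintype α] [DecidableEq α]

/-- A normal subgroup modulo which a transposition is central, and which contains an odd
permutation, contains the transposition. -/
theorem swap_mem_of_odd_mem {N : Subgroup (Perm α)} [N.Normal] {c : Perm α} {a b : α}
    (hab : a ≠ b) (hgen : Subgroup.closure {c, swap a b} = ⊤)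
    (hc : swap a b * (c⁻¹ * swap a b * c) ∈ N) {x : Perm α} (hx : x ∈ N)
    (hsign : sign x = -1) : swap a b ∈ N := by
  let q := QuotientGroup.mk' N
  have hq : ∀ g, q g = 1 ↔ g ∈ N := fun g => QuotientGroup.eq_one_iff g
  have htt : q (swap a b) * q (swap a b) = 1 := by rw [← map_mul, swap_mul_self, map_one]
  have hcomm : q c * q (swap a b) = q (swap a b) * q c := by
    have h1 : q (swap a b) * (q c)⁻¹ * q (swap a b) * q c = 1 := by
      rw [← (hq _).2 hc]; simp [mul_assoc]
    have h2 : q (swap a b) = q (swap a b) * (q (swap a b) * (q c)⁻¹ * q (swap a b) * q c) := by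
      rw [h1, mul_one]
    rw [← mul_assoc, ← mul_assoc, ← mul_assoc, htt, one_mul] at h2
    nth_rw 1 [h2]
    simp [mul_assoc]
  have hcent : ∀ g, q g * q (swap a b) = q (swap a b) * q g := by
    intro g
    have : (⊤ : Subgroup (Perm α)) ≤ (Subgroup.centralizer {q (swap a b)}).comap q := by
      rw [← hgen, Subgroup.closure_le]
      rintro y (rfl | rfl)
      · simpa [Subgroup.mem_centralizer_singleton_iff] using hcomm
      · simp [Subgroup.mem_centralizer_singleton_iff]
    simpa [Subgroup.mem_centralizer_singleton_iff] using this (Subgroup.mem_top g)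
  have hswap : ∀ u v, u ≠ v → q (swap u v) = q (swap a b) := by
    intro u v huv
    obtain ⟨g, hg⟩ := isConj_iff.1 (isConj_swap hab huv)
    rw [← hg, map_mul, map_mul, hcent, map_inv, mul_inv_cancel_right]
  have hall : ∀ g, q g = if sign g = 1 then 1 else q (swap a b) := by
    intro g
    induction g using swap_induction_on with
    | one => simp
    | swap_mul g u v huv ih =>
      rw [map_mul, hswap u v huv, ih, Perm.sign_mul, sign_swap huv]
      rcases Int.units_eq_one_or (sign g) with h | h <;> simp [h, htt]
  rw [← hq, ← (hq x).2 hx, hall x, hsign]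
  simp

/-- A normal subgroup containing a transposition is the whole symmetric group. -/
theorem eq_top_of_swap_mem {N : Subgroup (Perm α)} [N.Normal] {a b : α} (hab : a ≠ b)
    (h : swap a b ∈ N) : N = ⊤ := by
  rw [eq_top_iff, ← closure_isSwap, Subgroup.closure_le]
  rintro _ ⟨u, v, huv, rfl⟩
  obtain ⟨g, hg⟩ := isConj_iff.1 (isConj_swap hab huv)
  rw [← hg]
  exact Subgroup.Normal.conj_mem ‹_› _ h g

end SymmetricGroup

theorem closure_finRotate_swap (n : ℕ) :
    Subgroup.closure {finRotate (n + 2), swap (0 : Fin (n + 2)) 1} = ⊤ := by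
  have := closure_cycle_adjacent_swap (isCycle_finRotate (n := n)) support_finRotate 0
  simpa using this

theorem val_finRotate (m : ℕ) (j : Fin (m + 2)) :
    (finRotate (m + 2) j : ℕ) = if (j : ℕ) = m + 1 then 0 else (j : ℕ) + 1 := by
  rw [coe_finRotate]
  simp [Fin.ext_iff]

section Generators

variable (n m : ℕ) (hn : 2 ≤ n + 2) (hm : 2 ≤ m + 2)

theorem xi1_apply (i : Fin (n + 2)) (j : Fin (m + 2)) :
    xi1 (n + 2) (m + 2) hn hm (i, j) =
      (if j = 1 then swap 0 1 i else i, sbar (n + 2) (m + 2) hm j) := by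
  change ((if j = 1 then swap 0 1 else Equiv.refl _ : Perm (Fin (n + 2))) i, _) = _
  split_ifs <;> rfl

theorem xi2_apply (i : Fin (n + 2)) (j : Fin (m + 2)) :
    xi2 (n + 2) (m + 2) hn hm (i, j) =
      (if j = 0 then finRotate (n + 2) i else i, swap 0 1 j) := by
  change ((if j = 0 then finRotate (n + 2) else Equiv.refl _ : Perm (Fin (n + 2))) i, _) = _
  split_ifs <;> rfl

theorem xi2_inv_apply (i : Fin (n + 2)) (j : Fin (m + 2)) :
    (xi2 (n + 2) (m + 2) hn hm)⁻¹ (i, j) =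
      (if j = 1 then (finRotate (n + 2))⁻¹ i else i, swap 0 1 j) := by
  rw [inv_eq_iff_eq, xi2_apply, swap_apply_self]
  by_cases hj : j = 1
  · subst hj; simp
  · have : swap 0 1 j ≠ 0 := by
      rw [Ne, swap_apply_eq_iff, swap_apply_left]; exact hj
    simp [hj, this]

variable {n m hn hm}

theorem val_swap_finRotate (j : Fin (m + 2)) :
    (swap 0 1 (finRotate (m + 2) j)).val =
      if (j : ℕ) = 0 then 0 else if (j : ℕ) = m + 1 then 1 else (j : ℕ) + 1 := by
  have h := val_finRotate m j
  rw [swap_apply_def]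
  simp only [Fin.ext_iff, Fin.val_zero, Fin.val_one]
  split_ifs at h ⊢ <;> simp_all

/-- The power of a permutation that fixes the fibre over `0`, acting on it by `g`, and shifts
the other fibres cyclically with a twist by `(0 1)`. -/
theorem pow_eq_fibrewise_of_shift {y : Perm (Fin (n + 2) × Fin (m + 2))} {g : Perm (Fin (n + 2))}
    (hy : ∀ i j, y (i, j) = (if j = 0 then g i else if j = 1 then swap 0 1 i else i,
      swap 0 1 (finRotate (m + 2) j))) :
    y ^ (m + 1) = fibrewise _ _ (fun j => if j = 0 then g ^ (m + 1) else swap 0 1) := by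
  have hzero : ∀ k i, (y ^ k) (i, 0) = ((g ^ k) i, 0) := by
    intro k
    induction k with
    | zero => intro i; rfl
    | succ k ih =>
      intro i
      rw [pow_succ', mul_apply, ih, hy, pow_succ']
      simp
  refine Equiv.ext fun ⟨i, j⟩ => ?_
  rw [fibrewise_apply]
  by_cases hj : j = 0
  · subst hj
    simp [hzero]
  have hj0 : (j : ℕ) ≠ 0 := fun h => hj (Fin.ext h)
  let b : ℕ → Fin (m + 2) := fun k => if h : k < m then ⟨k + 2, by omega⟩ else 1
  have hb : ∀ k, (b k : ℕ) = if k < m then k + 2 else 1 := by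
    intro k
    by_cases h : k < m <;> simp [b, h]
  have hstep : ∀ k < m, ∀ i, y (i, b k) = (i, b (k + 1)) := by
    intro k hk i
    rw [hy]
    have h0 : b k ≠ 0 := by rw [Ne, Fin.ext_iff, hb]; simp [hk]
    have h1 : b k ≠ 1 := by rw [Ne, Fin.ext_iff, hb]; simp [hk]
    rw [if_neg h0, if_neg h1]
    refine Prod.ext rfl (Fin.ext ?_)
    change (swap 0 1 (finRotate (m + 2) (b k))).val = _
    rw [val_swap_finRotate, hb, hb]
    split_ifs <;> omega
  have hlast : ∀ i, y (i, b m) = (swap 0 1 i, b 0) := by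
    intro i
    have h1 : b m = 1 := by simp [b]
    rw [hy, h1]
    refine Prod.ext (by simp) (Fin.ext ?_)
    change (swap 0 1 (finRotate (m + 2) 1)).val = _
    rw [val_swap_finRotate, hb, Fin.val_one]
    split_ifs <;> omega
  obtain ⟨k, hk, rfl⟩ : ∃ k ≤ m, b k = j := by
    by_cases h : (j : ℕ) = 1
    · exact ⟨m, le_rfl, Fin.ext (by rw [hb, h]; simp)⟩
    · exact ⟨j - 2, by omega, Fin.ext (by rw [hb]; split_ifs <;> omega)⟩
  rw [pow_apply_of_cyclic_shift hstep hlast hk, if_neg hj]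

theorem xi1_pow_of_not_even (h : ¬(Even (m + 2) ∧ Even (n + 2))) :
    xi1 (n + 2) (m + 2) hn hm ^ (m + 2) = fibrewise _ _ (fun _ => swap 0 1) := by
  refine Equiv.ext fun ⟨i, j⟩ => ?_
  rw [fibrewise_apply]
  let b : ℕ → Fin (m + 2) := fun k => ⟨(k + 2) % (m + 2), Nat.mod_lt _ (by omega)⟩
  have hb : ∀ k < m, (b k : ℕ) = k + 2 := fun k hk => Nat.mod_eq_of_lt (by omega)
  have hbm : b m = 0 := Fin.ext (Nat.mod_self _)
  have hbm' : b (m + 1) = 1 := Fin.ext (by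
    change (m + 1 + 2) % (m + 2) = 1
    rw [show m + 1 + 2 = 1 + (m + 2) by omega, Nat.add_mod_right, Nat.mod_eq_of_lt (by omega)])
  have hrot : ∀ k, finRotate (m + 2) (b k) = b (k + 1) := by
    intro k
    rw [finRotate_apply]
    refine Fin.ext ?_
    rw [Fin.val_add]
    change ((k + 2) % (m + 2) + 1 % (m + 2)) % (m + 2) = (k + 1 + 2) % (m + 2)
    rw [← Nat.add_mod]
  have hsbar : sbar (n + 2) (m + 2) hm = finRotate (m + 2) := if_neg h
  have hstep : ∀ k < m + 1, ∀ i,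
      xi1 (n + 2) (m + 2) hn hm (i, b k) = (i, b (k + 1)) := by
    intro k hk i
    have h1 : b k ≠ 1 := by
      rcases Nat.lt_succ_iff_lt_or_eq.1 hk with hk | rfl
      · rw [Ne, Fin.ext_iff, hb k hk]; simp
      · rw [hbm]; simp
    rw [xi1_apply, if_neg h1, hsbar, hrot]
  have hlast : ∀ i, xi1 (n + 2) (m + 2) hn hm (i, b (m + 1)) = (swap 0 1 i, b 0) := by
    intro i
    rw [xi1_apply, if_pos hbm', hsbar, hrot]
    refine Prod.ext rfl (Fin.ext ?_)
    change (m + 1 + 1 + 2) % (m + 2) = (0 + 2) % (m + 2)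
    rw [show m + 1 + 1 + 2 = 0 + 2 + (m + 2) by omega, Nat.add_mod_right]
  obtain ⟨k, hk, rfl⟩ : ∃ k ≤ m + 1, b k = j := by
    by_cases h0 : (j : ℕ) = 0
    · exact ⟨m, by omega, hbm.trans (Fin.ext h0.symm)⟩
    by_cases h1 : (j : ℕ) = 1
    · exact ⟨m + 1, le_rfl, hbm'.trans (Fin.ext h1.symm)⟩
    · exact ⟨j - 2, by omega, Fin.ext (by rw [hb _ (by omega)]; omega)⟩
  exact pow_apply_of_cyclic_shift hstep hlast hk i

theorem exists_mem_snd_eq {H : Subgroup (Perm (Fin (n + 2) × Fin (m + 2)))}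
    (h1 : xi1 (n + 2) (m + 2) hn hm ∈ H) (h2 : xi2 (n + 2) (m + 2) hn hm ∈ H)
    (σ : Perm (Fin (m + 2))) : ∃ h ∈ H, ∀ p, (h p).2 = σ p.2 := by
  let S : Subgroup (Perm (Fin (m + 2))) :=
    { carrier := {σ | ∃ h ∈ H, ∀ p, (h p).2 = σ p.2}
      one_mem' := ⟨1, H.one_mem, fun _ => rfl⟩
      mul_mem' := by
        rintro a b ⟨h, hh, ha⟩ ⟨k, hk, hb⟩
        exact ⟨h * k, H.mul_mem hh hk, fun p => by simp [ha, hb]⟩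
      inv_mem' := by
        rintro a ⟨h, hh, ha⟩
        refine ⟨h⁻¹, H.inv_mem hh, fun p => ?_⟩
        rw [eq_inv_iff_eq, ← ha, Perm.inv_def, Equiv.apply_symm_apply] }
  have hS : Subgroup.closure {finRotate (m + 2), swap (0 : Fin (m + 2)) 1} ≤ S := by
    rw [Subgroup.closure_le]
    rintro _ (rfl | rfl)
    · by_cases h : Even (m + 2) ∧ Even (n + 2)
      · refine ⟨_, H.mul_mem h2 h1, fun ⟨i, j⟩ => ?_⟩
        have hs : sbar (n + 2) (m + 2) hm j = swap 0 1 (finRotate (m + 2) j) := by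
          rw [sbar, if_pos h]; rfl
        rw [mul_apply, xi1_apply, xi2_apply, hs, swap_apply_self]
      · refine ⟨_, h1, fun ⟨i, j⟩ => ?_⟩
        rw [xi1_apply, sbar, if_neg h]
    · exact ⟨_, h2, fun ⟨i, j⟩ => by rw [xi2_apply]⟩
  rw [closure_finRotate_swap] at hS
  exact hS (Subgroup.mem_top σ)

theorem xi2_sq : xi2 (n + 2) (m + 2) hn hm ^ 2 =
    fibrewise _ _ (fun j => if j = 0 ∨ j = 1 then finRotate (n + 2) else 1) := by
  refine Equiv.ext fun ⟨i, j⟩ => ?_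
  rw [pow_two, mul_apply, xi2_apply, xi2_apply, swap_apply_self, fibrewise_apply]
  by_cases h0 : j = 0
  · subst h0; simp
  by_cases hj : j = 1
  · subst hj; simp
  · simp [h0, hj, swap_apply_of_ne_of_ne h0 hj]

theorem fibrewise_swap_mem_of_even {H : Subgroup (Perm (Fin (n + 2) × Fin (m + 2)))}
    (h1 : xi1 (n + 2) (m + 2) hn hm ∈ H) (h2 : xi2 (n + 2) (m + 2) hn hm ∈ H)
    (h : Even (m + 2) ∧ Even (n + 2)) :
    fibrewise _ _ (Pi.mulSingle (0 : Fin (m + 2)) (swap (0 : Fin (n + 2)) 1)) ∈ H := by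
  have hs : ∀ j, sbar (n + 2) (m + 2) hm j = swap 0 1 (finRotate (m + 2) j) := by
    intro j; rw [sbar, if_pos h]; rfl
  refine fibrewise_mulSingle_mem (by simpa using h.1) (swap_mul_self _ _) ?_ 0
  suffices hk : ∀ (k : ℕ) (hk : k < m + 2), fibrewise (Fin (n + 2)) (Fin (m + 2))
      (fun l => if l = ⟨k, hk⟩ then 1 else swap 0 1) ∈ H from fun j => hk j j.2
  intro k
  induction k with
  | zero =>
    intro hk
    have hpow := pow_eq_fibrewise_of_shift (y := xi1 (n + 2) (m + 2) hn hm) (g := 1)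
      (fun i j => by
        rw [xi1_apply, hs]
        by_cases h0 : j = 0 <;> simp [h0])
    rw [one_pow] at hpow
    have := H.pow_mem h1 (m + 1)
    rwa [hpow] at this
  | succ k ih =>
    intro hk
    have ih' := ih (by omega)
    rcases Nat.eq_zero_or_pos k with rfl | hpos
    · refine fibrewise_mem_of_conj (σ := swap 0 1)
        (φ := fun j => if j = 0 then finRotate (n + 2) else 1) h2 (fun i k => ?_) ?_ ih'
      · rw [xi2_apply]
        split_ifs <;> rfl
      · intro k hk0
        have hk0' : k ≠ 0 := hk0
        simp [hk0']
    · have hσ : sbar (n + 2) (m + 2) hm ⟨k, by omega⟩ = ⟨k + 1, hk⟩ := by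
        rw [hs, Fin.ext_iff, val_swap_finRotate]
        change (if k = 0 then 0 else if k = m + 1 then 1 else k + 1) = k + 1
        split_ifs <;> omega
      rw [← hσ]
      refine fibrewise_mem_of_conj
        (φ := fun j => if j = 1 then swap 0 1 else 1) h1 (fun i k => ?_) ?_ ih'
      · rw [xi1_apply]
        split_ifs <;> rfl
      · intro k _
        split_ifs
        · exact Commute.refl _
        · exact Commute.one_left _

theorem sign_swap_mul_finRotate_pow (h : ¬(Even (m + 2) ∧ Even (n + 2))) :
    sign (swap (0 : Fin (n + 2)) 1 * (finRotate (n + 2))⁻¹ ^ (m + 1)) = -1 := by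
  rw [Perm.sign_mul, sign_swap (by simp), map_pow, Perm.sign_inv, sign_finRotate, ← pow_mul]
  have : Even ((n + 1) * (m + 1)) := by
    rw [Nat.even_mul]
    grind
  simp [this.neg_one_pow]

theorem fibrePerms_le_of_xi_mem {H : Subgroup (Perm (Fin (n + 2) × Fin (m + 2)))}
    (h1 : xi1 (n + 2) (m + 2) hn hm ∈ H) (h2 : xi2 (n + 2) (m + 2) hn hm ∈ H) :
    fibrePerms (Fin (n + 2)) (Fin (m + 2)) ≤ H := by
  refine fibrePerms_le (exists_mem_snd_eq h1 h2) 0 ?_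
  have hc : ∃ f, f 0 = finRotate (n + 2) ∧ fibrewise (Fin (n + 2)) (Fin (m + 2)) f ∈ H :=
    ⟨_, by simp, xi2_sq (hn := hn) (hm := hm) ▸ H.pow_mem h2 2⟩
  have hmem : ∀ g, g ∈ H.comap ((fibrewise (Fin (n + 2)) (Fin (m + 2))).comp
      (MonoidHom.mulSingle (fun _ => Perm (Fin (n + 2))) 0)) ↔
      fibrewise (Fin (n + 2)) (Fin (m + 2)) (Pi.mulSingle 0 g) ∈ H := fun _ => Iff.rfl
  suffices ∃ f, f 0 = swap 0 1 ∧ fibrewise (Fin (n + 2)) (Fin (m + 2)) f ∈ H ∧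
      ((H.comap ((fibrewise (Fin (n + 2)) (Fin (m + 2))).comp
        (MonoidHom.mulSingle (fun _ => Perm (Fin (n + 2))) 0))).Normal →
        fibrewise (Fin (n + 2)) (Fin (m + 2)) (Pi.mulSingle 0 (swap 0 1)) ∈ H) by
    obtain ⟨f, hf, hfH, hswap⟩ := this
    have hnormal := normal_comap_mulSingle (H := H) (0 : Fin (m + 2)) (closure_finRotate_swap n)
      (by
        rintro _ (rfl | rfl)
        · exact hc
        · exact ⟨f, hf, hfH⟩)
    have htop := eq_top_of_swap_mem (by simp) ((hmem _).2 (hswap hnormal))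
    exact fun g => (hmem g).1 (htop ▸ Subgroup.mem_top g)
  by_cases h : Even (m + 2) ∧ Even (n + 2)
  · have := fibrewise_swap_mem_of_even h1 h2 h
    exact ⟨_, by simp, this, fun _ => this⟩
  have hz := H.pow_mem h1 (m + 2)
  rw [xi1_pow_of_not_even h] at hz
  refine ⟨_, rfl, hz, fun hnormal => ?_⟩
  have hs : ∀ j, sbar (n + 2) (m + 2) hm j = finRotate (m + 2) j := by
    intro j; rw [sbar, if_neg h]
  have hp : ((xi2 (n + 2) (m + 2) hn hm)⁻¹ * xi1 (n + 2) (m + 2) hn hm) ^ (m + 1) =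
      fibrewise _ _ (fun j => if j = 0 then (finRotate (n + 2))⁻¹ ^ (m + 1) else swap 0 1) := by
    refine pow_eq_fibrewise_of_shift fun i j => ?_
    rw [mul_apply, xi1_apply, xi2_inv_apply, hs]
    by_cases h0 : j = 0
    · subst h0; simp
    · simp [h0]
  have hodd := H.mul_mem hz (H.pow_mem (H.mul_mem (H.inv_mem h2) h1) (m + 1))
  rw [hp, ← map_mul] at hodd
  have hconj : (xi2 (n + 2) (m + 2) hn hm)⁻¹ *
      fibrewise (Fin (n + 2)) (Fin (m + 2)) (fun _ => swap 0 1) * xi2 (n + 2) (m + 2) hn hm =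
      fibrewise _ _ (fun j => if j = 0 then
        (finRotate (n + 2))⁻¹ * swap 0 1 * finRotate (n + 2) else swap 0 1) := by
    refine Equiv.ext fun ⟨i, j⟩ => ?_
    rw [mul_apply, mul_apply, xi2_apply, fibrewise_apply, xi2_inv_apply, fibrewise_apply,
      swap_apply_self]
    by_cases h0 : j = 0
    · subst h0; simp
    · have : swap 0 1 j ≠ 1 := by
        rw [Ne, swap_apply_eq_iff, swap_apply_right]; exact h0
      simp [h0, this]
  have hcomm := H.mul_mem hz (H.mul_mem (H.mul_mem (H.inv_mem h2) hz) h2)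
  rw [hconj, ← map_mul] at hcomm
  refine (hmem _).1 (swap_mem_of_odd_mem (by simp) (closure_finRotate_swap n) ((hmem _).2 ?_)
    ((hmem _).2 ?_) (sign_swap_mul_finRotate_pow h))
  · convert hcomm using 2
    funext j
    by_cases h0 : j = 0
    · subst h0; simp
    · simp [h0]
  · convert hodd using 2
    funext j
    by_cases h0 : j = 0
    · subst h0; simp
    · simp [h0]

theorem closure_xi_eq_fibrePerms :
    Subgroup.closure {xi1 (n + 2) (m + 2) hn hm, xi2 (n + 2) (m + 2) hn hm} =
      fibrePerms (Fin (n + 2)) (Fin (m + 2)) := by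
  refine le_antisymm ?_ (fibrePerms_le_of_xi_mem (hn := hn) (hm := hm)
    (Subgroup.subset_closure (by simp)) (Subgroup.subset_closure (by simp)))
  rw [Subgroup.closure_le]
  rintro _ (rfl | rfl)
  · exact ⟨sbar (n + 2) (m + 2) hm, fun ⟨i, j⟩ => by rw [xi1_apply]⟩
  · exact ⟨swap 0 1, fun ⟨i, j⟩ => by rw [xi2_apply]⟩

theorem not_fibrePerms_le_closure_singleton (x : Perm (Fin (n + 2) × Fin (m + 2))) :
    ¬fibrePerms (Fin (n + 2)) (Fin (m + 2)) ≤ Subgroup.closure {x} := by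
  intro hx
  have hxi : xi2 (n + 2) (m + 2) (by omega) (by omega) ∈ Subgroup.closure {x} := by
    apply hx
    rw [← closure_xi_eq_fibrePerms (hn := by omega) (hm := by omega)]
    exact Subgroup.subset_closure (by simp)
  have hsingle : fibrewise (Fin (n + 2)) (Fin (m + 2)) (Pi.mulSingle 0 (swap 0 1)) ∈
      Subgroup.closure {x} := hx (fibrewise_mem_fibrePerms _)
  rw [Subgroup.mem_closure_singleton] at hxi hsingle
  obtain ⟨k, hk⟩ := hxi
  obtain ⟨l, hl⟩ := hsingle
  have hcomm := (Commute.refl x).zpow_zpow k l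
  rw [hk, hl] at hcomm
  have := congrArg (fun π : Perm _ => π (0, 1)) hcomm.eq
  simp [mul_apply, fibrewise_apply, xi2_apply] at this

end Generators

/-- The group `S_{n×m}` of `E`-preserving permutations is generated by `ξ1` and `ξ2`,
and the least cardinality of a generating set of `S_{n×m}` is 2. -/
theorem stmt11 (n m : ℕ) (hn : 2 ≤ n) (hm : 2 ≤ m) :
    ↑(Subgroup.closure {xi1 n m hn hm, xi2 n m hn hm}) =
        {π : Equiv.Perm (Fin n × Fin m) |
          ∀ (i k : Fin n) (j : Fin m), (π (i, j)).2 = (π (k, j)).2} ∧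
      IsLeast
        {c : ℕ | ∃ X : Finset (Equiv.Perm (Fin n × Fin m)), X.card = c ∧
            ↑(Subgroup.closure (X : Set (Equiv.Perm (Fin n × Fin m)))) =
              {π : Equiv.Perm (Fin n × Fin m) |
                ∀ (i k : Fin n) (j : Fin m), (π (i, j)).2 = (π (k, j)).2}}
        2 := by
  obtain ⟨n, rfl⟩ := Nat.exists_eq_add_of_le' hn
  obtain ⟨m, rfl⟩ := Nat.exists_eq_add_of_le' hm
  rw [← coe_fibrePerms, SetLike.coe_set_eq]
  simp only [SetLike.coe_set_eq]
  refine ⟨closure_xi_eq_fibrePerms,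
    ⟨{xi1 (n + 2) (m + 2) hn hm, xi2 (n + 2) (m + 2) hn hm}, Finset.card_pair ?_, ?_⟩, ?_⟩
  · intro h
    have := closure_xi_eq_fibrePerms (hn := hn) (hm := hm)
    rw [h, Set.pair_eq_singleton] at this
    exact not_fibrePerms_le_closure_singleton _ this.ge
  · rw [Finset.coe_pair]
    exact closure_xi_eq_fibrePerms
  · rintro c ⟨X, rfl, hX⟩
    by_contra! hc
    obtain ⟨x, hx⟩ := Finset.card_le_one_iff_subset_singleton.1 (Nat.le_of_lt_succ hc)
    refine not_fibrePerms_le_closure_singleton x ?_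
    rw [← hX]
    exact Subgroup.closure_mono (by exact_mod_cast hx)
end
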